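/- arXiv:2109.05355 — 3 statements merged into one kernel-verified Lean document; each statement's English description precedes it below -/
import Mathlib

section
/- Let a, b, c, d be complex numbers whose real parts lie in (0,1) and such that Re(a+b+c+d−1) > 0. Then ab·₃F₂(1−a, 1−b, 1; 1+c, 1+d; 1) + cd·₃F₂(1−c, 1−d, 1; 1+a, 1+b; 1) = Γ(a+b+c+d−1)·Γ(a+1)·Γ(b+1)·Γ(c+1)·Γ(d+1) / (Γ(a+c)·Γ(a+d)·Γ(b+c)·Γ(b+d)). -/
/-- The Pochhammer symbol (rising factorial) `(x)ₙ = x(x+1)⋯(x+n−1)`. -/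
noncomputable def poch (x : ℂ) (n : ℕ) : ℂ := ∏ i ∈ Finset.range n, (x + i)

/-- The generalized hypergeometric series `₃F₂(a₁,a₂,a₃; b₁,b₂; 1)`. -/
noncomputable def hyp3F2 (a₁ a₂ a₃ b₁ b₂ : ℂ) : ℂ :=
  ∑' n : ℕ, poch a₁ n * poch a₂ n * poch a₃ n / (poch b₁ n * poch b₂ n * (n.factorial : ℂ))

section Aux
open Complex MeasureTheory Filter Topology Set
open scoped Interval ComplexConjugate


noncomputable def II (p c : ℂ) : ℂ :=
  ∫ x in (-1/2:ℝ)..(1/2:ℝ), (1 + exp (2 * Real.pi * I * x)) ^ (p - 1) * exp (-c * (2 * Real.pi * I * x))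

lemma norm_E (x : ℝ) : ‖exp (2 * Real.pi * I * x)‖ = 1 := by
  have : (2 * Real.pi * I * x : ℂ) = ((2 * Real.pi * x : ℝ) : ℂ) * I := by push_cast; ring
  rw [this, norm_exp_ofReal_mul_I]

lemma cpow_bound (p w : ℂ) (hp : 1 < p.re) (hw : ‖w‖ ≤ 1) :
    ‖(1 + w) ^ (p - 1)‖ ≤ 2 ^ (p.re - 1) * Real.exp (Real.pi * |p.im|) := by
  refine (norm_cpow_le _ _).trans ?_
  rw [div_eq_mul_inv, ← Real.exp_neg]
  have h1 : ‖1 + w‖ ≤ 2 := by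
    refine (norm_add_le _ _).trans ?_
    simp; linarith
  simp only [sub_re, one_re, sub_im, one_im, sub_zero]
  gcongr
  · have h2 := abs_arg_le_pi (1 + w)
    calc -((1 + w).arg * p.im) ≤ |(1 + w).arg * p.im| := neg_le_abs _
      _ = |(1 + w).arg| * |p.im| := abs_mul _ _
      _ ≤ _ := by gcongr

lemma binom_hasSum (p w : ℂ) (hw : ‖w‖ < 1) :
    HasSum (fun k : ℕ => Ring.choose p k * w ^ k) ((1 + w) ^ p) := by
  have h := (one_add_cpow_hasFPowerSeriesOnBall_zero (a := p)).hasSum (y := w)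
    (by simpa [Metric.eball, edist_zero_right, enorm_eq_nnnorm] using (by exact_mod_cast hw))
  simp only [zero_add, binomialSeries_apply, List.ofFn_const, List.prod_replicate, smul_eq_mul] at h
  exact h

lemma binom_summable (p : ℂ) (r : ℝ) (h0 : 0 ≤ r) (hr : r < 1) :
    Summable (fun k : ℕ => ‖Ring.choose p k‖ * r ^ k) := by
  have := (binom_hasSum p (r : ℂ) (by rw [norm_real, Real.norm_of_nonneg h0]; exact hr)).summable.norm
  simpa [abs_of_nonneg h0] using this

lemma J_hasSum (p c : ℂ) (r : ℝ) (h0 : 0 ≤ r) (hr : r < 1) :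
    HasSum (fun k : ℕ => Ring.choose (p-1) k * r ^ k *
        ∫ x in (-1/2:ℝ)..(1/2:ℝ), exp ((k - c) * (2 * Real.pi * I * x)))
      (∫ x in (-1/2:ℝ)..(1/2:ℝ), (1 + r * exp (2 * Real.pi * I * x)) ^ (p - 1) *
        exp (-c * (2 * Real.pi * I * x))) := by
  simp_rw [← intervalIntegral.integral_const_mul]
  obtain ⟨M, hM⟩ : ∃ M, ∀ x ∈ Icc (-1/2:ℝ) (1/2:ℝ), ‖exp (-c * (2 * Real.pi * I * x))‖ ≤ M := by
    apply isCompact_Icc.exists_bound_of_continuousOn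
    fun_prop
  have hmem : ∀ t : ℝ, t ∈ Ι (-1/2:ℝ) (1/2) → t ∈ Icc (-1/2:ℝ) (1/2) := by
    intro t ht; rw [uIoc_of_le (by norm_num)] at ht; exact Ioc_subset_Icc_self ht
  have hE : ∀ (k : ℕ) (t : ℝ), exp ((k - c) * (2 * Real.pi * I * t)) =
      exp (2 * Real.pi * I * t) ^ k * exp (-c * (2 * Real.pi * I * t)) := by
    intro k t
    rw [← exp_nat_mul, ← exp_add]; ring_nf
  refine intervalIntegral.hasSum_integral_of_dominated_convergence
    (fun k _ => ‖Ring.choose (p-1) k‖ * r ^ k * M) ?_ ?_ ?_ ?_ ?_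
  · intro k
    exact Continuous.aestronglyMeasurable (by fun_prop)
  · intro k
    refine Eventually.of_forall fun t ht => ?_
    rw [hE, norm_mul, norm_mul, norm_mul, norm_pow, norm_pow, norm_E, norm_real, Real.norm_of_nonneg h0]
    have := hM t (hmem t ht)
    simp only [one_pow, one_mul]
    gcongr
  · refine Eventually.of_forall fun t ht => ?_
    exact (binom_summable _ r h0 hr).mul_right _
  · exact intervalIntegrable_const
  · refine Eventually.of_forall fun t ht => ?_
    have := (binom_hasSum (p-1) (r * exp (2 * Real.pi * I * t)) (by
      rw [norm_mul, norm_E, norm_real, Real.norm_of_nonneg h0]; simpa using hr)).mul_right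
        (exp (-c * (2 * Real.pi * I * t)))
    refine this.congr_fun ?_ 
    intro k
    simp only [hE, mul_pow]; ring

lemma K_hasSum (p c : ℂ) (hc : c.re < 0) (r : ℝ) (h0 : 0 ≤ r) (hr : r < 1) :
    HasSum (fun k : ℕ => Ring.choose (p-1) k * (-r) ^ k * (1 / (k - c)))
      (∫ x in (0:ℝ)..1, (x : ℂ) ^ (-c - 1) * (1 - r * x) ^ (p - 1)) := by
  have hIntg : ∀ k : ℕ, ∫ x in (0:ℝ)..1, (x:ℂ) ^ ((k:ℂ) - c - 1) = 1 / (k - c) := by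
    intro k
    have hre : 0 < ((k:ℂ) - c).re := by
      simp only [sub_re, natCast_re]
      have : (0:ℝ) ≤ k := Nat.cast_nonneg k
      linarith
    rw [integral_cpow]
    · have : (k:ℂ) - c ≠ 0 := fun h => by rw [h] at hre; simp at hre
      simp [zero_cpow this]
    · left; simp only [sub_re, one_re] at hre ⊢; linarith
  simp_rw [← hIntg, ← intervalIntegral.integral_const_mul]
  refine intervalIntegral.hasSum_integral_of_dominated_convergence
    (fun k x => ‖Ring.choose (p-1) k‖ * r ^ k * x ^ (-c.re - 1)) ?_ ?_ ?_ ?_ ?_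
  · intro k
    exact Measurable.aestronglyMeasurable (by fun_prop)
  · intro k
    refine Eventually.of_forall fun t ht => ?_
    rw [uIoc_of_le zero_le_one] at ht
    rw [norm_mul, norm_mul, norm_pow, norm_neg, norm_real, Real.norm_of_nonneg h0,
      norm_cpow_eq_rpow_re_of_pos ht.1]
    refine mul_le_mul_of_nonneg_left ?_ (by positivity)
    apply Real.rpow_le_rpow_of_exponent_ge ht.1 ht.2
    simp
  · refine Eventually.of_forall fun t ht => ?_
    exact (binom_summable _ r h0 hr).mul_right _
  · simp_rw [tsum_mul_right]
    apply IntervalIntegrable.const_mul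
    apply intervalIntegral.intervalIntegrable_rpow'
    linarith
  · refine Eventually.of_forall fun t ht => ?_
    rw [uIoc_of_le zero_le_one] at ht
    have := (binom_hasSum (p-1) (-(r * t)) (by
      rw [norm_neg, norm_mul, norm_real, norm_real, Real.norm_of_nonneg h0, Real.norm_of_nonneg ht.1.le]
      nlinarith [ht.1, ht.2])).mul_left ((t:ℂ) ^ (-c - 1))
    rw [← sub_eq_add_neg] at this
    refine this.congr_fun ?_ 
    intro k
    have ht0 : (t:ℂ) ≠ 0 := by exact_mod_cast ht.1.ne'
    have : (k:ℂ) - c - 1 = k + (-c - 1) := by ring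
    rw [this, cpow_add _ _ ht0, cpow_natCast, neg_pow (r:ℂ), neg_pow (r * t : ℂ), mul_pow]; ring

lemma int_exp (z : ℂ) (hz : z ≠ 0) :
    ∫ x in (-1/2:ℝ)..(1/2:ℝ), exp (z * (2 * Real.pi * I * x)) = sin (Real.pi * z) / (Real.pi * z) := by
  have hpi : (Real.pi : ℂ) ≠ 0 := by exact_mod_cast Real.pi_ne_zero
  have h1 : ∀ x : ℝ, exp (z * (2 * Real.pi * I * x)) = exp ((z * (2 * Real.pi * I)) * x) := by
    intro x; ring_nf
  simp_rw [h1]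
  rw [integral_exp_mul_complex (by simp [hz, hpi])]
  rw [Complex.sin]
  have e1 : z * (2 * Real.pi * I) * ((1/2 : ℝ) : ℂ) = Real.pi * z * I := by push_cast; ring
  have e2 : z * (2 * Real.pi * I) * ((-1/2 : ℝ) : ℂ) = -(Real.pi * z) * I := by push_cast; ring
  rw [e1, e2]
  field_simp
  rw [I_sq]; ring

lemma JK (p c : ℂ) (hc : c.re < 0) (r : ℝ) (h0 : 0 ≤ r) (hr : r < 1) :
    (∫ x in (-1/2:ℝ)..(1/2:ℝ), (1 + r * exp (2 * Real.pi * I * x)) ^ (p - 1) *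
        exp (-c * (2 * Real.pi * I * x))) = -(sin (Real.pi * c) / Real.pi) *
      (∫ x in (0:ℝ)..1, (x : ℂ) ^ (-c - 1) * (1 - r * x) ^ (p - 1)) := by
  have h1 := J_hasSum p c r h0 hr
  have h2 := (K_hasSum p c hc r h0 hr).mul_left (-(sin (Real.pi * c) / Real.pi))
  refine h1.unique (h2.congr_fun ?_)
  intro k
  have hk : (k:ℂ) - c ≠ 0 := by
    intro h
    have := congrArg re h
    simp only [sub_re, natCast_re, zero_re] at this
    have : (0:ℝ) ≤ k := Nat.cast_nonneg k
    linarith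
  rw [int_exp _ hk]
  have : sin (Real.pi * ((k:ℂ) - c)) = -(-1)^k * sin (Real.pi * c) := by
    have : (Real.pi * ((k:ℂ) - c)) = -(Real.pi * c - k * Real.pi) := by ring
    rw [this, Complex.sin_neg, Complex.sin_antiperiodic.sub_nat_mul_eq]
    ring
  have hpi : (Real.pi : ℂ) ≠ 0 := by exact_mod_cast Real.pi_ne_zero
  rw [this, neg_pow (r:ℂ)]
  field_simp

lemma slit_add (w : ℂ) (hw : ‖w‖ ≤ 1) (h : w ≠ -1) : 1 + w ∈ slitPlane := by
  left
  simp only [add_re, one_re]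
  by_contra hcon
  have h1 : w.re ≤ -1 := by linarith
  have h2 : normSq w ≤ 1 := by rw [normSq_eq_norm_sq]; nlinarith [norm_nonneg w]
  rw [normSq_apply] at h2
  apply h
  apply Complex.ext
  · simp; nlinarith [mul_self_nonneg w.im]
  · simp; nlinarith [mul_self_nonneg w.im]

lemma E_ne (x : ℝ) (hx : x ∈ Ioo (-1/2:ℝ) (1/2)) : exp (2 * Real.pi * I * x) ≠ -1 := by
  intro h
  have h3 := congrArg Complex.log h
  have h2 : (2 * Real.pi * I * x : ℂ) = ((2 * Real.pi * x : ℝ) : ℂ) * I := by push_cast; ring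
  rw [h2, log_exp, log_neg_one] at h3
  · have := congrArg im h3
    simp at this
    nlinarith [Real.pi_pos, hx.2]
  · simp; nlinarith [Real.pi_pos, hx.1]
  · simp; nlinarith [Real.pi_pos, hx.2]

lemma J_tendsto (p c : ℂ) (hp : 1 < p.re) :
    Tendsto (fun r : ℝ => ∫ x in (-1/2:ℝ)..(1/2:ℝ), (1 + r * exp (2 * Real.pi * I * x)) ^ (p - 1) *
        exp (-c * (2 * Real.pi * I * x))) (𝓝[<] 1) (𝓝 (II p c)) := by
  obtain ⟨M, hM⟩ : ∃ M, ∀ x ∈ Icc (-1/2:ℝ) (1/2:ℝ), ‖exp (-c * (2 * Real.pi * I * x))‖ ≤ M := by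
    apply isCompact_Icc.exists_bound_of_continuousOn
    fun_prop
  have hmem : ∀ t : ℝ, t ∈ Ι (-1/2:ℝ) (1/2) → t ∈ Icc (-1/2:ℝ) (1/2) := by
    intro t ht; rw [uIoc_of_le (by norm_num)] at ht; exact Ioc_subset_Icc_self ht
  have hev : ∀ᶠ r : ℝ in 𝓝[<] 1, r ∈ Ioo (0:ℝ) 1 := Ioo_mem_nhdsLT zero_lt_one
  refine intervalIntegral.tendsto_integral_filter_of_dominated_convergence
    (fun _ => 2 ^ (p.re - 1) * Real.exp (Real.pi * |p.im|) * M) ?_ ?_ ?_ ?_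
  · exact Eventually.of_forall fun r => Measurable.aestronglyMeasurable (by fun_prop)
  · filter_upwards [hev] with r hr
    refine Eventually.of_forall fun t ht => ?_
    rw [norm_mul]
    refine mul_le_mul (cpow_bound p _ hp ?_) (hM t (hmem t ht)) (norm_nonneg _) (by positivity)
    rw [norm_mul, norm_E, norm_real, Real.norm_of_nonneg hr.1.le, mul_one]; exact hr.2.le
  · exact intervalIntegrable_const
  · have : ∀ᵐ x : ℝ, x ≠ 1/2 := by
      simp [ae_iff, measure_singleton]
    filter_upwards [this] with x hx hx2
    rw [uIoc_of_le (by norm_num)] at hx2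
    have hne := E_ne x ⟨hx2.1, lt_of_le_of_ne hx2.2 hx⟩
    apply Tendsto.mul_const
    have hc : ContinuousAt (fun r : ℝ => (1 + r * exp (2 * Real.pi * I * x)) ^ (p - 1)) 1 := by
      apply ContinuousAt.cpow (by fun_prop) (by fun_prop)
      simpa using slit_add _ (norm_E x).le hne
    have := hc.tendsto.mono_left (nhdsWithin_le_nhds (s := Iio 1))
    simpa using this

lemma K_tendsto (p c : ℂ) (hp : 1 < p.re) (hc : c.re < 0) :
    Tendsto (fun r : ℝ => ∫ x in (0:ℝ)..1, (x : ℂ) ^ (-c - 1) * (1 - r * x) ^ (p - 1))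
      (𝓝[<] 1) (𝓝 (betaIntegral (-c) p)) := by
  have hev : ∀ᶠ r : ℝ in 𝓝[<] 1, r ∈ Ioo (0:ℝ) 1 := Ioo_mem_nhdsLT zero_lt_one
  rw [betaIntegral]
  refine intervalIntegral.tendsto_integral_filter_of_dominated_convergence
    (fun x => x ^ (-c.re - 1) * (2 ^ (p.re - 1) * Real.exp (Real.pi * |p.im|))) ?_ ?_ ?_ ?_
  · exact Eventually.of_forall fun r => Measurable.aestronglyMeasurable (by fun_prop)
  · filter_upwards [hev] with r hr
    refine Eventually.of_forall fun t ht => ?_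
    rw [uIoc_of_le zero_le_one] at ht
    rw [norm_mul, norm_cpow_eq_rpow_re_of_pos ht.1]
    have h3 : ‖(-(r * t) : ℂ)‖ ≤ 1 := by
      rw [norm_neg, norm_mul, norm_real, norm_real, Real.norm_of_nonneg hr.1.le, Real.norm_of_nonneg ht.1.le]
      nlinarith [ht.1, ht.2, hr.1, hr.2]
    have := cpow_bound p _ hp h3
    rw [← sub_eq_add_neg] at this
    simp only [sub_re, neg_re, one_re]
    exact mul_le_mul_of_nonneg_left this (Real.rpow_nonneg ht.1.le _)
  · apply IntervalIntegrable.mul_const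
    apply intervalIntegral.intervalIntegrable_rpow'
    linarith
  · have : ∀ᵐ x : ℝ, x ≠ 1 := by
      simp [ae_iff, measure_singleton]
    filter_upwards [this] with x hx hx2
    rw [uIoc_of_le zero_le_one] at hx2
    apply Tendsto.const_mul
    have hc : ContinuousAt (fun r : ℝ => (1 - r * x : ℂ) ^ (p - 1)) 1 := by
      apply ContinuousAt.cpow (by fun_prop) (by fun_prop)
      left
      simp
      exact lt_of_le_of_ne hx2.2 hx
    have := hc.tendsto.mono_left (nhdsWithin_le_nhds (s := Iio 1))
    simpa using this

lemma II_neg (p c : ℂ) (hp : 1 < p.re) (hc : c.re < 0) :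
    II p c = Gamma p * (Gamma (1 + c))⁻¹ * (Gamma (p - c))⁻¹ := by
  have h1 := J_tendsto p c hp
  have h2 := (K_tendsto p c hp hc).const_mul (-(sin (Real.pi * c) / Real.pi))
  have hev : ∀ᶠ r : ℝ in 𝓝[<] 1, r ∈ Ioo (0:ℝ) 1 := Ioo_mem_nhdsLT zero_lt_one
  have h3 := tendsto_nhds_unique (h1.congr' (by
    filter_upwards [hev] with r hr using JK p c hc r hr.1.le hr.2)) h2
  rw [h3]
  have hb := Gamma_mul_Gamma_eq_betaIntegral (s := -c) (t := p) (by simpa using hc) (by linarith)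
  have hG : Gamma (p - c) ≠ 0 := Gamma_ne_zero_of_re_pos (by simp; linarith)
  rw [show -c + p = p - c by ring] at hb
  have hr := Gamma_mul_Gamma_one_sub (-c)
  rw [sub_neg_eq_add, mul_neg, Complex.sin_neg] at hr
  have hG2 : Gamma (-c) ≠ 0 := Gamma_ne_zero_of_re_pos (by simpa using hc)
  have hpi : (Real.pi : ℂ) ≠ 0 := by exact_mod_cast Real.pi_ne_zero
  have hr2 : (Gamma (1 + c))⁻¹ = Gamma (-c) * (-(sin (Real.pi * c) / Real.pi)) := by
    have e : Gamma (1 + c) = Real.pi / -sin (Real.pi * c) / Gamma (-c) := by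
      rw [← hr]; field_simp
    rw [e, inv_div, div_div_eq_mul_div]; ring
  rw [hr2]
  have : betaIntegral (-c) p = Gamma (-c) * Gamma p * (Gamma (p - c))⁻¹ := by
    rw [hb]; field_simp
  rw [this]; ring

lemma II_zero (p : ℂ) (hp : 1 < p.re) : II p 0 = 1 := by
  have h1 := J_tendsto p 0 hp
  have hev : ∀ᶠ r : ℝ in 𝓝[<] 1, r ∈ Ioo (0:ℝ) 1 := Ioo_mem_nhdsLT zero_lt_one
  refine tendsto_nhds_unique (h1.congr' (f₂ := fun _ => 1) ?_) tendsto_const_nhds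
  filter_upwards [hev] with r hr
  refine (J_hasSum p 0 r hr.1.le hr.2).unique ?_
  have : ∀ k : ℕ, k ≠ 0 → Ring.choose (p-1) k * r ^ k *
        ∫ x in (-1/2:ℝ)..(1/2:ℝ), exp ((k - 0) * (2 * Real.pi * I * x)) = 0 := by
    intro k hk
    rw [sub_zero, int_exp _ (by exact_mod_cast hk), mul_comm (Real.pi:ℂ) (k:ℂ), Complex.sin_nat_mul_pi]
    simp
  convert hasSum_single 0 this
  simp
  norm_num

lemma II_rec (p c : ℂ) (hp : 1 < p.re) : (p - c) * II p (c - 1) = c * II p c := by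
  set f' : ℝ → ℂ := fun x => 2 * Real.pi * I * ((p - c) *
    ((1 + exp (2 * Real.pi * I * x)) ^ (p - 1) * exp (-(c - 1) * (2 * Real.pi * I * x))) -
    c * ((1 + exp (2 * Real.pi * I * x)) ^ (p - 1) * exp (-c * (2 * Real.pi * I * x)))) with hf'
  have hIntg : ∀ c : ℂ, IntervalIntegrable (fun x : ℝ => (1 + exp (2 * Real.pi * I * x)) ^ (p - 1) *
      exp (-c * (2 * Real.pi * I * x))) volume (-1/2) (1/2) := by
    intro c
    obtain ⟨M, hM⟩ : ∃ M, ∀ x ∈ Icc (-1/2:ℝ) (1/2:ℝ), ‖exp (-c * (2 * Real.pi * I * x))‖ ≤ M := by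
      apply isCompact_Icc.exists_bound_of_continuousOn
      fun_prop
    rw [intervalIntegrable_iff_integrableOn_Ioc_of_le (by norm_num)]
    refine Measure.integrableOn_of_bounded (M := 2 ^ (p.re - 1) * Real.exp (Real.pi * |p.im|) * M) (by simp) (Measurable.aestronglyMeasurable (by fun_prop)) ?_
    refine (ae_restrict_iff' measurableSet_Ioc).2 (Eventually.of_forall fun t ht => ?_)
    rw [norm_mul]
    exact mul_le_mul (cpow_bound p _ hp (norm_E t).le) (hM t (Ioc_subset_Icc_self ht)) (norm_nonneg _) (by positivity)
  have hp0 : p ≠ 0 := by rintro rfl; simp at hp; linarith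
  have key : ∫ x in (-1/2:ℝ)..(1/2:ℝ), f' x = 0 := by
    have hE1 : exp (2 * Real.pi * I * ((1/2 : ℝ) : ℂ)) = -1 := by
      rw [← exp_pi_mul_I]; congr 1; push_cast; ring
    have hE2 : exp (2 * Real.pi * I * ((-1/2 : ℝ) : ℂ)) = -1 := by
      have : (2 * Real.pi * I * ((-1/2 : ℝ) : ℂ)) = -(Real.pi * I) := by push_cast; ring
      rw [this, exp_neg, exp_pi_mul_I]; norm_num
    rw [intervalIntegral.integral_eq_sub_of_hasDerivAt_of_le (f := fun x : ℝ =>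
      (1 + exp (2 * Real.pi * I * x)) ^ p * exp (-c * (2 * Real.pi * I * x))) (by norm_num)]
    · rw [hE1, hE2]; simp [hp0]
    · apply Continuous.continuousOn
      apply Continuous.mul _ (by fun_prop)
      rw [continuous_iff_continuousAt]
      intro x
      by_cases h : exp (2 * Real.pi * I * x) = -1
      · have h2 : ContinuousAt (fun z : ℂ => z ^ p) 0 := by
          apply continuousAt_cpow_const_of_re_pos (by simp) (by linarith)
        have h4 : ContinuousAt (fun x : ℝ => 1 + exp (2 * Real.pi * I * x)) x := by fun_prop
        refine ContinuousAt.comp (g := fun z : ℂ => z ^ p) ?_ h4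
        simpa [h] using h2
      · apply ContinuousAt.cpow (by fun_prop) (by fun_prop)
        exact slit_add _ (norm_E x).le h
    · intro x hx
      have hs := slit_add _ (norm_E x).le (E_ne x hx)
      have hl : HasDerivAt (fun z : ℂ => 2 * Real.pi * I * z) (2 * Real.pi * I) (x : ℂ) := by
        simpa using (hasDerivAt_id (x : ℂ)).const_mul (2 * Real.pi * I : ℂ)
      have h1 := ((hl.cexp.const_add 1).cpow_const (c := p) hs).mul ((hl.const_mul (-c)).cexp)
      refine h1.comp_ofReal.congr_deriv ?_
      simp only [hf']
      have hne : 1 + exp (2 * Real.pi * I * x) ≠ 0 := slitPlane_ne_zero hs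
      have e1 : (1 + exp (2 * Real.pi * I * x)) ^ p = (1 + exp (2 * Real.pi * I * x)) ^ (p - 1) * (1 + exp (2 * Real.pi * I * x)) := by
        rw [cpow_sub _ _ hne, cpow_one]; field_simp
      have e2 : exp (-(c - 1) * (2 * Real.pi * I * x)) = exp (-c * (2 * Real.pi * I * x)) * exp (2 * Real.pi * I * x) := by
        rw [← exp_add]; ring_nf
      rw [e1, e2]; ring
    · exact (((hIntg (c-1)).const_mul (p - c)).sub ((hIntg c).const_mul c)).const_mul _
  simp only [hf'] at key
  rw [intervalIntegral.integral_const_mul, intervalIntegral.integral_sub ((hIntg (c-1)).const_mul (p - c)) ((hIntg c).const_mul c),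
    intervalIntegral.integral_const_mul, intervalIntegral.integral_const_mul] at key
  have hpi : (2 * Real.pi * I : ℂ) ≠ 0 := by simp [Real.pi_ne_zero]
  have := (mul_eq_zero.1 key).resolve_left hpi
  exact sub_eq_zero.1 this

lemma II_eq (p c : ℂ) (hp : 1 < p.re) :
    II p c = Gamma p * (Gamma (1 + c))⁻¹ * (Gamma (p - c))⁻¹ := by
  obtain ⟨n, hn⟩ := exists_nat_gt c.re
  induction n generalizing c with
  | zero => exact II_neg p c hp (by simpa using hn)
  | succ n ih =>
    by_cases hc : c = 0
    · subst hc
      have : Gamma p ≠ 0 := Gamma_ne_zero_of_re_pos (by linarith)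
      rw [II_zero p hp]; simp [this]
    have h := ih (c - 1) (by push_cast at hn; simp; linarith)
    have hr := II_rec p c hp
    rw [h] at hr
    have e1 := one_div_Gamma_eq_self_mul_one_div_Gamma_add_one c
    have e2 := one_div_Gamma_eq_self_mul_one_div_Gamma_add_one (p - c)
    rw [show 1 + (c - 1) = c by ring, show p - (c - 1) = p - c + 1 by ring, e1] at hr
    rw [e2, add_comm 1 c]
    apply mul_left_cancel₀ hc
    rw [← hr]; ring

noncomputable def phi (p c : ℂ) (x : UnitAddCircle) : ℂ :=
  (1 + fourier 1 x) ^ (p - 1) * (fourier 1 x : ℂ) ^ (-c)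

lemma fourier_E (n : ℤ) (x : ℝ) : (fourier n (x : UnitAddCircle) : ℂ) = exp (n * (2 * Real.pi * I * x)) := by
  rw [fourier_coe_apply]; congr 1; push_cast; ring

lemma phi_meas (p c : ℂ) : Measurable (phi p c) := by
  unfold phi
  have : Measurable (fun x : UnitAddCircle => (fourier 1 x : ℂ)) := (map_continuous (fourier 1)).measurable
  fun_prop

lemma phi_bound (p c : ℂ) (hp : 1 < p.re) : ∃ M, ∀ x, ‖phi p c x‖ ≤ M := by
  refine ⟨2 ^ (p.re - 1) * Real.exp (Real.pi * |p.im|) * Real.exp (Real.pi * |c.im|), fun x => ?_⟩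
  have h1 : ‖(fourier 1 x : ℂ)‖ = 1 := by rw [fourier_apply]; exact Circle.norm_coe _
  rw [phi, norm_mul]
  refine mul_le_mul (cpow_bound p _ hp h1.le) ?_ (norm_nonneg _) (by positivity)
  refine (norm_cpow_le _ _).trans ?_
  rw [h1, Real.one_rpow, one_div, ← Real.exp_neg]
  gcongr
  have h2 := abs_arg_le_pi (fourier 1 x : ℂ)
  calc -((fourier 1 x : ℂ).arg * (-c).im) ≤ |(fourier 1 x : ℂ).arg * (-c).im| := neg_le_abs _
    _ = |(fourier 1 x : ℂ).arg| * |c.im| := by rw [abs_mul]; simp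
    _ ≤ _ := by gcongr

lemma phi_memLp (p c : ℂ) (hp : 1 < p.re) : MemLp (phi p c) 2 (AddCircle.haarAddCircle (T := 1)) := by
  obtain ⟨M, hM⟩ := phi_bound p c hp
  exact MemLp.of_bound (phi_meas p c).aestronglyMeasurable M (Eventually.of_forall hM)

lemma phi_apply (p c : ℂ) (x : ℝ) (hx : x ∈ Ioc (-1/2:ℝ) (1/2)) :
    phi p c x = (1 + exp (2 * Real.pi * I * x)) ^ (p - 1) * exp (-c * (2 * Real.pi * I * x)) := by
  rw [phi, fourier_E, Int.cast_one, one_mul]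
  congr 1
  rw [cpow_def_of_ne_zero (exp_ne_zero _)]
  have h2 : (2 * Real.pi * I * x : ℂ) = ((2 * Real.pi * x : ℝ) : ℂ) * I := by push_cast; ring
  rw [h2, log_exp]
  · ring_nf
  · simp; nlinarith [Real.pi_pos, hx.1]
  · simp; nlinarith [Real.pi_pos, hx.2]

lemma phi_coeff (p c : ℂ) (n : ℤ) : fourierCoeff (phi p c) n = II p (c + n) := by
  rw [fourierCoeff_eq_intervalIntegral _ _ (-1/2), II]
  norm_num only [one_div, inv_one, one_smul]
  apply intervalIntegral.integral_congr_ae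
  refine Eventually.of_forall fun x hx => ?_
  rw [uIoc_of_le (by norm_num)] at hx
  rw [phi_apply p c x (by rw [neg_div]; exact hx), fourier_E, smul_eq_mul, mul_left_comm, ← exp_add]
  push_cast
  ring_nf

lemma phi_mul (p c q e : ℂ) (hp : 1 < p.re) (hq : 1 < q.re) (x : UnitAddCircle) :
    phi p c x * phi q e x = phi (p + q - 1) (c + e) x := by
  simp only [phi]
  have h1 : (fourier 1 x : ℂ) ≠ 0 := by rw [fourier_apply]; exact Circle.coe_ne_zero _
  have h2 : (1 + (fourier 1 x : ℂ)) ^ (p + q - 1 - 1) = (1 + (fourier 1 x : ℂ)) ^ (p - 1) * (1 + (fourier 1 x : ℂ)) ^ (q - 1) := by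
    by_cases h : 1 + (fourier 1 x : ℂ) = 0
    · have a1 : p - 1 ≠ 0 := by
        intro h; have := congrArg re h; simp at this; linarith
      have a2 : p + q - 1 - 1 ≠ 0 := by
        intro h; have := congrArg re h; simp at this; linarith
      rw [h, zero_cpow a1, zero_cpow a2, zero_mul]
    · rw [← cpow_add _ _ h]; ring_nf
  rw [h2, neg_add, cpow_add _ _ h1]; ring

lemma parseval (f g : UnitAddCircle → ℂ) (hf : MemLp f 2 (AddCircle.haarAddCircle (T := 1)))
    (hg : MemLp g 2 (AddCircle.haarAddCircle (T := 1))) :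
    HasSum (fun n : ℤ => fourierCoeff f (-n) * fourierCoeff g n) (fourierCoeff (fun x => f x * g x) 0) := by
  have hf2 : MemLp (fun x => conj (f x)) 2 (AddCircle.haarAddCircle (T := 1)) := hf.star
  have h := (fourierBasis (T := 1)).hasSum_inner_mul_inner (hf2.toLp _) (hg.toLp _)
  have e1 : ∀ n : ℤ, inner ℂ (fourierBasis (T := 1) n) (hg.toLp _) = fourierCoeff g n := by
    intro n
    rw [← HilbertBasis.repr_apply_apply, fourierBasis_repr, fourierCoeff_congr_ae hg.coeFn_toLp]
  have e2 : ∀ n : ℤ, inner ℂ (hf2.toLp _) (fourierBasis (T := 1) n) = fourierCoeff f (-n) := by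
    intro n
    rw [← inner_conj_symm, ← HilbertBasis.repr_apply_apply, fourierBasis_repr, fourierCoeff_congr_ae hf2.coeFn_toLp,
      fourierCoeff, fourierCoeff, ← integral_conj]
    simp only [smul_eq_mul, map_mul, fourier_neg, RingHomCompTriple.comp_apply, RingHom.id_apply]
  have e3 : inner ℂ (hf2.toLp _) (hg.toLp _) = fourierCoeff (fun x => f x * g x) 0 := by
    rw [L2.inner_def, fourierCoeff]
    apply integral_congr_ae
    filter_upwards [hf2.coeFn_toLp, hg.coeFn_toLp] with x h1 h2
    rw [h1, h2]; simp [mul_comm]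
  simp_rw [e1, e2, e3] at h
  exact h

lemma dougall_big (a b c d : ℂ) (h1 : 1 < (a + c).re) (h2 : 1 < (b + d).re) :
    HasSum (fun n : ℤ => (Gamma (a - n))⁻¹ * (Gamma (b - n))⁻¹ * (Gamma (1 + c + n))⁻¹ * (Gamma (1 + d + n))⁻¹)
      (Gamma (a + b + c + d - 1) * (Gamma (a + c))⁻¹ * (Gamma (a + d))⁻¹ * (Gamma (b + c))⁻¹ * (Gamma (b + d))⁻¹) := by
  have h := parseval _ _ (phi_memLp (b + d) (b - 1) h2) (phi_memLp (a + c) c h1)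
  simp_rw [phi_mul _ _ _ _ h2 h1, phi_coeff] at h
  have g1 : Gamma (a + c) ≠ 0 := Gamma_ne_zero_of_re_pos (by linarith)
  have g2 : Gamma (b + d) ≠ 0 := Gamma_ne_zero_of_re_pos (by linarith)
  simp_rw [II_eq _ _ h1, II_eq _ _ h2] at h
  rw [II_eq _ _ (by simp only [add_re, sub_re, one_re] at *; linarith)] at h
  have h' := h.mul_left ((Gamma (a + c))⁻¹ * (Gamma (b + d))⁻¹)
  have ev : Gamma (a + b + c + d - 1) * (Gamma (a + c))⁻¹ * (Gamma (a + d))⁻¹ * (Gamma (b + c))⁻¹ *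
      (Gamma (b + d))⁻¹ = (Gamma (a + c))⁻¹ * (Gamma (b + d))⁻¹ *
      (Gamma (b + d + (a + c) - 1) * (Gamma (1 + (b - 1 + c + ((0 : ℤ) : ℂ))))⁻¹ *
        (Gamma (b + d + (a + c) - 1 - (b - 1 + c + ((0 : ℤ) : ℂ))))⁻¹) := by
    push_cast
    rw [show b + d + (a + c) - 1 = a + b + c + d - 1 by ring,
      show 1 + (b - 1 + c + 0) = b + c by ring,
      show a + b + c + d - 1 - (b - 1 + c + 0) = a + d by ring]
    ring
  rw [ev]
  refine h'.congr_fun fun n => ?_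
  push_cast
  rw [show 1 + (b - 1 + -(n:ℂ)) = b - n by ring, show b + d - (b - 1 + -(n:ℂ)) = 1 + d + n by ring,
    show a + c - (c + n) = a - n by ring, show 1 + (c + (n:ℂ)) = 1 + c + n by ring]
  field_simp
lemma iG_rec (z : ℂ) : (Gamma z)⁻¹ = z * (Gamma (z + 1))⁻¹ :=
  one_div_Gamma_eq_self_mul_one_div_Gamma_add_one z

lemma iG_sub (x : ℂ) (n : ℕ) : (Gamma (x - n))⁻¹ = (-1) ^ n * poch (1 - x) n * (Gamma x)⁻¹ := by
  induction n with
  | zero => simp [poch]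
  | succ n ih =>
    rw [iG_rec, show x - ((n + 1 : ℕ) : ℂ) + 1 = x - n by push_cast; ring, ih, poch, poch,
      Finset.prod_range_succ, pow_succ]
    push_cast; ring

lemma poch_ne (y : ℂ) (hy : 0 < y.re) (n : ℕ) : poch y n ≠ 0 := by
  rw [poch, Finset.prod_ne_zero_iff]
  intro i _ h
  have := congrArg re h
  simp at this
  have : (0:ℝ) ≤ i := Nat.cast_nonneg i
  linarith

lemma iG_add (y : ℂ) (hy : 0 < y.re) (n : ℕ) : (Gamma (y + n))⁻¹ = (poch y n)⁻¹ * (Gamma y)⁻¹ := by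
  induction n with
  | zero => simp [poch]
  | succ n ih =>
    have h0 := poch_ne y hy (n+1)
    rw [iG_rec (y + n)] at ih
    rw [poch, Finset.prod_range_succ] at h0 ⊢
    have h1 := right_ne_zero_of_mul h0
    push_cast
    rw [poch] at ih
    rw [← add_assoc]
    apply mul_left_cancel₀ h1
    rw [ih, mul_inv]
    field_simp

lemma iG_bigO (x y : ℂ) (hx : ∀ m : ℤ, x ≠ m) (hy : 0 < y.re) :
    (fun n : ℕ => (Gamma (x - n))⁻¹ * (Gamma (y + n))⁻¹) =O[atTop]
      (fun n : ℕ => (n : ℝ) ^ (1 - (x + y).re)) := by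
  have hG : Gamma (1 - x) ≠ 0 := by
    apply Gamma_ne_zero
    intro m h
    apply hx (m + 1)
    push_cast
    linear_combination -h
  have hl : Tendsto (fun n : ℕ => (Gamma x)⁻¹ * (Gamma y)⁻¹ * (GammaSeq y n / GammaSeq (1 - x) n *
      ((y + 1 * n) / (1 - x + 1 * n)))) atTop
      (𝓝 ((Gamma x)⁻¹ * (Gamma y)⁻¹ * (Gamma y / Gamma (1 - x) * (1 / 1)))) :=
    (((GammaSeq_tendsto_Gamma y).div (GammaSeq_tendsto_Gamma (1 - x)) hG).mul
      (tendsto_add_mul_div_add_mul_atTop_nhds _ _ _ one_ne_zero)).const_mul _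
  have hO := (hl.isBigO_one ℝ).norm_left.mul (Asymptotics.isBigO_refl (fun n : ℕ => (n : ℝ) ^ (1 - (x + y).re)) atTop)
  simp only [one_mul] at hO
  refine Asymptotics.IsBigO.trans (Asymptotics.IsBigO.of_bound 1 ?_) hO
  filter_upwards [eventually_gt_atTop 0] with n hn
  rw [one_mul, Real.norm_of_nonneg (mul_nonneg (norm_nonneg _) (Real.rpow_nonneg (Nat.cast_nonneg n) _))]
  have hn0 : (n : ℂ) ≠ 0 := by exact_mod_cast hn.ne'
  have hp1 : ∀ k, poch (1 - x) k ≠ 0 := by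
    intro k
    rw [poch, Finset.prod_ne_zero_iff]
    intro i _ h
    apply hx (i + 1)
    push_cast
    linear_combination -h
  have hp2 := poch_ne y hy
  have hnorm : ‖(n : ℂ) ^ (1 - x - y)‖ = (n : ℝ) ^ (1 - (x + y).re) := by
    rw [norm_natCast_cpow_of_pos hn]; congr 1; simp; ring
  rw [← hnorm, iG_sub, iG_add y hy]
  simp only [GammaSeq]
  have a1 : ∏ j ∈ Finset.range (n + 1), (y + j) = poch y n * (y + n) := by
    rw [Finset.prod_range_succ, poch]
  have a2 : ∏ j ∈ Finset.range (n + 1), (1 - x + j) = poch (1 - x) n * (1 - x + n) := by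
    rw [Finset.prod_range_succ, poch]
  have b1 : y + n ≠ 0 := by
    have := hp2 (n+1); rw [poch, a1] at this; exact right_ne_zero_of_mul this
  have b2 : 1 - x + n ≠ 0 := by
    have := hp1 (n+1); rw [poch, a2] at this; exact right_ne_zero_of_mul this
  have c1 : (n : ℂ) ^ (1 - x) ≠ 0 := by simp [cpow_eq_zero_iff, hn0]
  have c2 : (n : ℂ) ^ y ≠ 0 := by simp [cpow_eq_zero_iff, hn0]
  have c3 : (n.factorial : ℂ) ≠ 0 := by exact_mod_cast n.factorial_ne_zero
  have hp1n := hp1 n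
  have hp2n := hp2 n
  rw [a1, a2, cpow_sub (1 - x) y hn0, ← norm_mul]
  apply le_of_eq
  have e : (Gamma x)⁻¹ * (Gamma y)⁻¹ *
        ((n:ℂ) ^ y * n.factorial / (poch y n * (y + n)) / ((n:ℂ) ^ (1 - x) * n.factorial / (poch (1 - x) n * (1 - x + n))) *
          ((y + n) / (1 - x + n))) * ((n:ℂ) ^ (1 - x) / (n:ℂ) ^ y) =
      poch (1 - x) n * (Gamma x)⁻¹ * ((poch y n)⁻¹ * (Gamma y)⁻¹) := by
    field_simp
  rw [e, mul_assoc, mul_assoc, norm_mul, norm_pow, norm_neg, norm_one, one_pow, one_mul, ← mul_assoc]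

noncomputable def UU (a b c d : ℂ) (n : ℤ) : ℂ :=
  (Gamma (a - n))⁻¹ * (Gamma (b - n))⁻¹ * (Gamma (1 + c + n))⁻¹ * (Gamma (1 + d + n))⁻¹

lemma nonint_add_one {x : ℂ} (hx : ∀ m : ℤ, x ≠ m) : ∀ m : ℤ, 1 + x ≠ m := by
  intro m h
  apply hx (m - 1)
  push_cast
  linear_combination h

lemma four_bigO (x y x' y' : ℂ) (hx : ∀ m : ℤ, x ≠ m) (hy : 0 < y.re)
    (hx' : ∀ m : ℤ, x' ≠ m) (hy' : 0 < y'.re) :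
    (fun n : ℕ => (Gamma (x - n))⁻¹ * (Gamma (x' - n))⁻¹ * (Gamma (y + n))⁻¹ * (Gamma (y' + n))⁻¹)
     =O[atTop] (fun n : ℕ => (n : ℝ) ^ (2 - (x + y + x' + y').re)) := by
  refine ((iG_bigO x y hx hy).mul (iG_bigO x' y' hx' hy')).congr' ?_ ?_
  · exact Eventually.of_forall fun n => by ring
  · filter_upwards [eventually_gt_atTop 0] with n hn
    rw [← Real.rpow_add (by exact_mod_cast hn)]
    congr 1; simp; ring

lemma UU_summable (a b c d : ℂ) (ha : 0 < a.re) (hb : 0 < b.re) (hc : 0 < c.re) (hd : 0 < d.re)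
    (ha' : ∀ m : ℤ, a ≠ m) (hb' : ∀ m : ℤ, b ≠ m) (hc' : ∀ m : ℤ, c ≠ m) (hd' : ∀ m : ℤ, d ≠ m)
    (hs : 0 < (a + b + c + d - 1).re) : Summable (UU a b c d) := by
  simp only [add_re, sub_re, one_re] at hs
  apply Summable.of_nat_of_neg
  · refine summable_of_isBigO_nat (Real.summable_nat_rpow.2 ?_)
      ((four_bigO a (1 + c) b (1 + d) ha' (by simp; linarith) hb' (by simp; linarith)).congr_left ?_)
    · simp; linarith
    · intro n; simp [UU]
  · refine summable_of_isBigO_nat (Real.summable_nat_rpow.2 ?_)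
      ((four_bigO (1 + c) a (1 + d) b (nonint_add_one hc') ha (nonint_add_one hd') hb).congr_left ?_)
    · simp; linarith
    · intro n; simp [UU, ← sub_eq_add_neg]; ring

lemma telescope (g R : ℤ → ℂ) (hg : Summable g) (h : ∀ n, g n = R n - R (n + 1))
    (h1 : Tendsto (fun n : ℕ => R n) atTop (𝓝 0)) (h2 : Tendsto (fun n : ℕ => R (-n)) atTop (𝓝 0)) :
    ∑' n, g n = 0 := by
  have h3 := hg.hasSum.nat_add_neg_add_one.tendsto_sum_nat
  have h4 : ∀ N : ℕ, ∑ n ∈ Finset.range N, (g n + g (-(n + 1))) = R (-N) - R N := by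
    intro N
    induction N with
    | zero => simp
    | succ N ih =>
      rw [Finset.sum_range_succ, ih, h, h]
      push_cast
      rw [show (-((N:ℤ) + 1) + 1) = -N by ring]
      ring
  simp_rw [h4] at h3
  have h5 := h2.sub h1
  rw [sub_zero] at h5
  exact tendsto_nhds_unique h3 h5

lemma UU_rec (a b c d : ℂ) (ha : 0 < a.re) (hb : 0 < b.re) (hc : 0 < c.re) (hd : 0 < d.re)
    (ha' : ∀ m : ℤ, a ≠ m) (hb' : ∀ m : ℤ, b ≠ m) (hc' : ∀ m : ℤ, c ≠ m) (hd' : ∀ m : ℤ, d ≠ m)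
    (hs : 0 < (a + b + c + d - 1).re) :
    (a + c) * (a + d) * ∑' n, UU (1 + a) b c d n = (a + b + c + d - 1) * ∑' n, UU a b c d n := by
  have s1 := UU_summable a b c d ha hb hc hd ha' hb' hc' hd' hs
  have s2 := UU_summable (1 + a) b c d (by simp; linarith) hb hc hd (nonint_add_one ha') hb' hc' hd'
    (by simp at hs ⊢; linarith)
  simp only [add_re, sub_re, one_re] at hs
  rw [← sub_eq_zero, ← tsum_mul_left, ← tsum_mul_left, ← (s2.mul_left _).tsum_sub (s1.mul_left _)]
  have hexp : ∀ z : ℂ, z.re > 2 → Tendsto (fun n : ℕ => (n : ℝ) ^ (2 - z.re)) atTop (𝓝 0) := by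
    intro z hz
    have := (tendsto_rpow_neg_atTop (y := z.re - 2) (by linarith)).comp tendsto_natCast_atTop_atTop
    simpa [Function.comp_def] using this
  apply telescope _ (fun n => (Gamma (1 + a - n))⁻¹ * (Gamma (b - n))⁻¹ * (Gamma (c + n))⁻¹ * (Gamma (d + n))⁻¹)
  · exact (s2.mul_left _).sub (s1.mul_left _)
  · intro n
    simp only [UU]
    have e1 := iG_rec (a - n)
    have e2 := iG_rec (b - (n + 1))
    have e3 := iG_rec (c + n)
    have e4 := iG_rec (d + n)
    push_cast
    rw [show a - n + 1 = 1 + a - n by ring] at e1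
    rw [show b - ((n:ℂ) + 1) + 1 = b - n by ring] at e2
    rw [show c + (n:ℂ) + 1 = 1 + c + n by ring] at e3
    rw [show d + (n:ℂ) + 1 = 1 + d + n by ring] at e4
    rw [show 1 + a - ((n:ℂ) + 1) = a - n by ring, show c + ((n:ℂ) + 1) = 1 + c + n by ring,
      show d + ((n:ℂ) + 1) = 1 + d + n by ring, e1, e2, e3, e4]
    ring
  · refine ((four_bigO (1 + a) c b d (nonint_add_one ha') hc hb' hd).trans_tendsto (hexp _ ?_)).congr ?_
    · simp; linarith
    · intro n; simp
  · refine ((four_bigO c (1 + a) d b hc' (by simp; linarith) hd' hb).trans_tendsto (hexp _ ?_)).congr ?_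
    · simp; linarith
    · intro n; simp [← sub_eq_add_neg]; ring

lemma UU_swap (a b c d : ℂ) : UU a b c d = UU b a c d := by
  funext n; simp only [UU]; ring

lemma nonint_strip {x : ℂ} (h : 0 < x.re ∧ x.re < 1) : ∀ m : ℤ, x ≠ m := by
  intro m hm
  rw [hm] at h
  simp only [intCast_re] at h
  have h1 : (0:ℤ) < m := by exact_mod_cast h.1
  have h2 : m < (1:ℤ) := by exact_mod_cast h.2
  omega

lemma dougall (a b c d : ℂ)
    (ha : 0 < a.re ∧ a.re < 1) (hb : 0 < b.re ∧ b.re < 1)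
    (hc : 0 < c.re ∧ c.re < 1) (hd : 0 < d.re ∧ d.re < 1)
    (hsum : 0 < (a + b + c + d - 1).re) :
    ∑' n, UU a b c d n = Gamma (a + b + c + d - 1) * (Gamma (a + c))⁻¹ * (Gamma (a + d))⁻¹ *
      (Gamma (b + c))⁻¹ * (Gamma (b + d))⁻¹ := by
  have ha' := nonint_strip ha
  have hb' := nonint_strip hb
  have hc' := nonint_strip hc
  have hd' := nonint_strip hd
  have r1 := UU_rec b a c d hb.1 ha.1 hc.1 hd.1 hb' ha' hc' hd'
    (by simp only [add_re, sub_re, one_re] at *; linarith)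
  have r2 := UU_rec a (1 + b) c d ha.1 (by simp; linarith) hc.1 hd.1 ha' (nonint_add_one hb') hc' hd'
    (by simp only [add_re, sub_re, one_re] at *; linarith)
  have r3 : ∑' n, UU (1 + a) (1 + b) c d n = _ := (dougall_big (1 + a) (1 + b) c d
    (by simp only [add_re, one_re]; linarith) (by simp only [add_re, one_re]; linarith)).tsum_eq
  rw [UU_swap b a, UU_swap (1 + b) a] at r1
  rw [r3] at r2
  have s0 : a + b + c + d - 1 ≠ 0 := by intro h; rw [h] at hsum; simp at hsum
  have s1 : a + (1 + b) + c + d - 1 ≠ 0 := by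
    intro h
    have := congrArg re h
    simp only [add_re, sub_re, one_re, zero_re] at *
    linarith
  have g1 := Gamma_add_one _ s0
  have g2 := Gamma_add_one _ s1
  rw [show a + b + c + d - 1 + 1 = a + (1 + b) + c + d - 1 by ring] at g1
  rw [show a + (1 + b) + c + d - 1 + 1 = 1 + a + (1 + b) + c + d - 1 by ring] at g2
  rw [g2, g1] at r2
  rw [iG_rec (a + c), iG_rec (a + d), iG_rec (b + c), iG_rec (b + d)]
  rw [show 1 + a + c = a + c + 1 by ring, show 1 + a + d = a + d + 1 by ring,
    show 1 + b + c = b + c + 1 by ring, show 1 + b + d = b + d + 1 by ring] at r2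
  apply mul_left_cancel₀ s0
  rw [show a + b + c + d - 1 = b + a + c + d - 1 by ring, ← r1]
  apply mul_left_cancel₀ s1
  rw [show b + a + c + d - 1 = a + b + c + d - 1 by ring]
  linear_combination (-(b + c) * (b + d)) * r2

lemma half (a b c d : ℂ) (hc : 0 < c.re) (hd : 0 < d.re) (ha : 0 < a.re) (hb : 0 < b.re) :
    a * b * hyp3F2 (1 - a) (1 - b) 1 (1 + c) (1 + d) =
    Gamma (a + 1) * Gamma (b + 1) * Gamma (c + 1) * Gamma (d + 1) * ∑' n : ℕ, UU a b c d n := by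
  rw [hyp3F2, ← tsum_mul_left, ← tsum_mul_left]
  congr 1
  funext n
  have hone : poch 1 n = n.factorial := by
    rw [poch, ← Finset.prod_range_add_one_eq_factorial]
    push_cast
    exact Finset.prod_congr rfl fun i _ => by ring
  have c3 : (n.factorial : ℂ) ≠ 0 := by exact_mod_cast n.factorial_ne_zero
  have hc1 : 0 < (1 + c).re := by simp; linarith
  have hd1 : 0 < (1 + d).re := by simp; linarith
  have p1 := poch_ne (1 + c) hc1 n
  have p2 := poch_ne (1 + d) hd1 n
  have G1 := Gamma_ne_zero_of_re_pos ha
  have G2 := Gamma_ne_zero_of_re_pos hb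
  have G3 := Gamma_ne_zero_of_re_pos hc1
  have G4 := Gamma_ne_zero_of_re_pos hd1
  have a0 : a ≠ 0 := by rintro rfl; simp at ha
  have b0 : b ≠ 0 := by rintro rfl; simp at hb
  simp only [UU, Int.cast_natCast]
  rw [hone, iG_sub, iG_sub, iG_add _ hc1, iG_add _ hd1, Gamma_add_one _ a0, Gamma_add_one _ b0,
    add_comm c 1, add_comm d 1]
  have hsq : ((-1:ℂ) ^ n) * (-1) ^ n = 1 := by rw [← mul_pow]; simp
  have : (-1:ℂ) ^ n * poch (1 - a) n * (Gamma a)⁻¹ * ((-1) ^ n * poch (1 - b) n * (Gamma b)⁻¹) =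
      poch (1 - a) n * (Gamma a)⁻¹ * (poch (1 - b) n * (Gamma b)⁻¹) := by
    linear_combination (poch (1 - a) n * (Gamma a)⁻¹ * (poch (1 - b) n * (Gamma b)⁻¹)) * hsq
  rw [this]
  field_simp

theorem stmt8_aux (a b c d : ℂ)
    (ha : 0 < a.re ∧ a.re < 1) (hb : 0 < b.re ∧ b.re < 1)
    (hc : 0 < c.re ∧ c.re < 1) (hd : 0 < d.re ∧ d.re < 1)
    (hsum : 0 < (a + b + c + d - 1).re) :
    a * b * hyp3F2 (1 - a) (1 - b) 1 (1 + c) (1 + d)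
      + c * d * hyp3F2 (1 - c) (1 - d) 1 (1 + a) (1 + b)
      = Complex.Gamma (a + b + c + d - 1) * Complex.Gamma (a + 1) * Complex.Gamma (b + 1) *
          Complex.Gamma (c + 1) * Complex.Gamma (d + 1) /
        (Complex.Gamma (a + c) * Complex.Gamma (a + d) * Complex.Gamma (b + c) *
          Complex.Gamma (b + d)) := by
  rw [half a b c d hc.1 hd.1 ha.1 hb.1, half c d a b ha.1 hb.1 hc.1 hd.1]
  have hS := UU_summable a b c d ha.1 hb.1 hc.1 hd.1 (nonint_strip ha) (nonint_strip hb)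
    (nonint_strip hc) (nonint_strip hd) hsum
  have hD := dougall a b c d ha hb hc hd hsum
  have hneg : ∀ n : ℕ, UU c d a b n = UU a b c d (-(n + 1)) := by
    intro n
    simp only [UU]
    push_cast
    rw [show a - -((n:ℂ) + 1) = 1 + a + n by ring, show b - -((n:ℂ) + 1) = 1 + b + n by ring,
      show 1 + c + -((n:ℂ) + 1) = c - n by ring, show 1 + d + -((n:ℂ) + 1) = d - n by ring]
    ring
  have hinj1 : Summable (fun n : ℕ => UU a b c d n) := hS.comp_injective Nat.cast_injective
  have hinj2 : Summable (fun n : ℕ => UU a b c d (-(n + 1))) :=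
    hS.comp_injective (i := fun n : ℕ => -((n:ℤ) + 1)) (fun x y h => by simpa using h)
  have hsplit := tsum_of_nat_of_neg_add_one hinj1 hinj2
  simp_rw [hneg]
  rw [hD] at hsplit
  rw [div_eq_mul_inv, mul_inv, mul_inv, mul_inv]
  linear_combination (-(Gamma (a + 1) * Gamma (b + 1) * Gamma (c + 1) * Gamma (d + 1))) * hsplit

end Aux

/-- Two-term ₃F₂(1) identity:
`ab·₃F₂(1−a,1−b,1;1+c,1+d;1) + cd·₃F₂(1−c,1−d,1;1+a,1+b;1)
  = Γ(a+b+c+d−1)Γ(a+1)Γ(b+1)Γ(c+1)Γ(d+1)/(Γ(a+c)Γ(a+d)Γ(b+c)Γ(b+d))`. -/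
theorem stmt8 (a b c d : ℂ)
    (ha : 0 < a.re ∧ a.re < 1) (hb : 0 < b.re ∧ b.re < 1)
    (hc : 0 < c.re ∧ c.re < 1) (hd : 0 < d.re ∧ d.re < 1)
    (hsum : 0 < (a + b + c + d - 1).re) :
    a * b * hyp3F2 (1 - a) (1 - b) 1 (1 + c) (1 + d)
      + c * d * hyp3F2 (1 - c) (1 - d) 1 (1 + a) (1 + b)
      = Complex.Gamma (a + b + c + d - 1) * Complex.Gamma (a + 1) * Complex.Gamma (b + 1) *
          Complex.Gamma (c + 1) * Complex.Gamma (d + 1) /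
        (Complex.Gamma (a + c) * Complex.Gamma (a + d) * Complex.Gamma (b + c) *
          Complex.Gamma (b + d)) := by
  exact stmt8_aux a b c d ha hb hc hd hsum
end

section
/- Let A, A', A'' be complex numbers with positive real parts satisfying A + A' + A'' = 1. Define f(κ) = c_q · G_q(−e^{Aℏ}) · G_q(e^{A'ℏ}) · G_q(e^{A''ℏ}) where ℏ = −1/κ, q = e^{ℏ}. Then f(κ) = κ·B(A', A'')·(1 + O(κ^{−2})) as κ → +∞, where B(x,y) = Γ(x)Γ(y)/Γ(x+y) is the Euler beta function; moreover this holds uniformly for A, A' on compact subsets of the right half-plane. -/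
/-- The infinite q-Pochhammer symbol `(z;q)_∞ = ∏_{n ≥ 0} (1 − qⁿ z)`. -/
noncomputable def qPochInf (z q : ℂ) : ℂ := ∏' n : ℕ, (1 - q ^ n * z)

/-- `G_q(z) = (−q z⁻¹; q)_∞ / (z; q)_∞`. -/
noncomputable def Gq (q z : ℂ) : ℂ := qPochInf (-q * z⁻¹) q / qPochInf z q

/-- The normalisation constant `c_q = (q;q)_∞² / (q²;q²)_∞`. -/
noncomputable def cq (q : ℂ) : ℂ := qPochInf q q ^ 2 / qPochInf (q ^ 2) (q ^ 2)

/-- Euler's beta function `B(x,y) = Γ(x)Γ(y)/Γ(x+y)`. -/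
noncomputable def betaC (x y : ℂ) : ℂ :=
  Complex.Gamma x * Complex.Gamma y / Complex.Gamma (x + y)

/-- The tetrahedral weight `f(κ) = c_q · G_q(−e^{Aℏ}) · G_q(e^{A'ℏ}) · G_q(e^{A''ℏ})`
with `ℏ = −1/κ`, `q = e^{ℏ}`. -/
noncomputable def fGK (A A' A'' : ℂ) (κ : ℝ) : ℂ :=
  cq (Complex.exp (-1 / (κ : ℂ))) *
    Gq (Complex.exp (-1 / (κ : ℂ))) (-Complex.exp (A * (-1 / (κ : ℂ)))) *
    Gq (Complex.exp (-1 / (κ : ℂ))) (Complex.exp (A' * (-1 / (κ : ℂ)))) *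
    Gq (Complex.exp (-1 / (κ : ℂ))) (Complex.exp (A'' * (-1 / (κ : ℂ))))

open Complex Filter Topology

namespace GKaux

/-- second-order Taylor estimates on a segment -/
lemma taylor (u u1 u2 u3 : ℂ → ℂ) (z w : ℂ) (M : ℝ)
    (h1 : ∀ x ∈ segment ℝ z (z + w), HasDerivAt u (u1 x) x)
    (h2 : ∀ x ∈ segment ℝ z (z + w), HasDerivAt u1 (u2 x) x)
    (h3 : ∀ x ∈ segment ℝ z (z + w), HasDerivAt u2 (u3 x) x)
    (hb : ∀ x ∈ segment ℝ z (z + w), ‖u3 x‖ ≤ M) :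
    ‖u1 (z + w) - u1 z - w * u2 z‖ ≤ M * ‖w‖ ^ 2 ∧
    ‖u (z + w) - u z - w * u1 z - w ^ 2 / 2 * u2 z‖ ≤ M * ‖w‖ ^ 3 := by
  have hz : z ∈ segment ℝ z (z + w) := left_mem_segment ℝ _ _
  have hw : z + w ∈ segment ℝ z (z + w) := right_mem_segment ℝ _ _
  have hc : Convex ℝ (segment ℝ z (z + w)) := convex_segment _ _
  have hM : 0 ≤ M := (norm_nonneg _).trans (hb z hz)
  have hd : ∀ x ∈ segment ℝ z (z + w), ‖x - z‖ ≤ ‖w‖ := by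
    intro x hx
    obtain ⟨θ, hθ, rfl⟩ := (segment_eq_image' ℝ z (z + w)).subset hx
    simp only [add_sub_cancel_left, norm_smul, Real.norm_eq_abs, abs_of_nonneg hθ.1]
    nlinarith [norm_nonneg w, hθ.2]
  have e2 : ∀ x ∈ segment ℝ z (z + w), ‖u2 x - u2 z‖ ≤ M * ‖w‖ := by
    intro x hx
    have := hc.norm_image_sub_le_of_norm_hasDerivWithin_le
      (fun x hx => (h3 x hx).hasDerivWithinAt) hb hz hx
    exact this.trans (by gcongr; exact hd x hx)
  have e1 : ∀ x ∈ segment ℝ z (z + w), ‖u1 x - u1 z - (x - z) * u2 z‖ ≤ M * ‖w‖ ^ 2 := by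
    intro x hx
    have := hc.norm_image_sub_le_of_norm_hasDerivWithin_le (f := fun x => u1 x - (x - z) * u2 z)
      (f' := fun x => u2 x - u2 z)
      (fun x hx => by
        have := (h2 x hx).sub (((hasDerivAt_id x).sub_const z).mul_const (u2 z))
        exact (this.congr_deriv (by simp)).hasDerivWithinAt) e2 hz hx
    have h' : u1 x - u1 z - (x - z) * u2 z = (u1 x - (x - z) * u2 z) - (u1 z - (z - z) * u2 z) := by
      ring
    rw [h']
    refine this.trans ?_
    rw [pow_two, ← mul_assoc]
    gcongr
    exact hd x hx
  refine ⟨by simpa using e1 _ hw, ?_⟩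
  have := hc.norm_image_sub_le_of_norm_hasDerivWithin_le
      (f := fun x => u x - (x - z) * u1 z - (x - z) ^ 2 / 2 * u2 z)
      (f' := fun x => u1 x - u1 z - (x - z) * u2 z)
      (fun x hx => by
        have := ((h1 x hx).sub (((hasDerivAt_id x).sub_const z).mul_const (u1 z))).sub
          (((((hasDerivAt_id x).sub_const z).pow 2).div_const 2).mul_const (u2 z))
        refine HasDerivAt.hasDerivWithinAt ?_
        exact this.congr_deriv (by simp)) e1 hz hw
  calc _ = ‖(u (z + w) - (z + w - z) * u1 z - (z + w - z) ^ 2 / 2 * u2 z) -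
        (u z - (z - z) * u1 z - (z - z) ^ 2 / 2 * u2 z)‖ := by
          congr 1; ring
    _ ≤ _ := this
    _ = _ := by simp; ring

lemma sum_bound (h : ℝ) (h0 : 0 < h) (h1 : h ≤ 1) (N : ℕ) :
    ∑ n ∈ Finset.range N, 1 / (1 + n * h) ^ 2 ≤ 2 / h := by
  have : ∑ n ∈ Finset.range N, 1 / (1 + n * h) ^ 2 ≤ 2 / h * (1 - 1 / (1 + N * h)) := by
    induction N with
    | zero => simp
    | succ N ih =>
      rw [Finset.sum_range_succ]
      have ht : 0 ≤ (N : ℝ) * h := by positivity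
      push_cast
      have e : 2 / h * (1 - 1 / (1 + (N + 1) * h)) = 2 / h * (1 - 1 / (1 + N * h)) +
          2 / ((1 + N * h) * (1 + (N + 1) * h)) := by
        have : 1 + (N : ℝ) * h ≠ 0 := by positivity
        have : 1 + ((N : ℝ) + 1) * h ≠ 0 := by positivity
        field_simp
        ring
      rw [e]
      refine add_le_add ih ?_
      rw [div_le_div_iff₀ (by positivity) (by positivity)]
      nlinarith
  refine this.trans ?_
  have : 0 ≤ 1 / (1 + (N : ℝ) * h) := by positivity
  have h2 : 0 < 2 / h := by positivity
  nlinarith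

lemma exp_bound (x : ℝ) (hx : 0 ≤ x) : Real.exp (-x) ≤ 2 / (1 + x) ^ 2 := by
  rw [Real.exp_neg, inv_eq_one_div, div_le_div_iff₀ (Real.exp_pos _) (by positivity)]
  nlinarith [Real.quadratic_le_exp_of_nonneg hx]

/-! ### the function `log (1 + e^{-z})` -/

noncomputable def v (z : ℂ) : ℂ := log (1 + exp (-z))
noncomputable def v1 (z : ℂ) : ℂ := -(exp (-z) / (1 + exp (-z)))
noncomputable def v2 (z : ℂ) : ℂ := exp (-z) / (1 + exp (-z)) ^ 2
noncomputable def v3 (z : ℂ) : ℂ := -(exp (-z) * (1 - exp (-z)) / (1 + exp (-z)) ^ 3)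

lemma re_exp_pos (z : ℂ) (hz : |z.im| < 1) : 0 < (exp (-z)).re := by
  rw [exp_re]
  refine mul_pos (Real.exp_pos _) (Real.cos_pos_of_mem_Ioo ?_)
  have := Real.pi_gt_three
  rw [abs_lt] at hz
  simp only [neg_im]
  constructor <;> linarith

lemma V_re (z : ℂ) (hz : |z.im| < 1) : 1 < (1 + exp (-z)).re := by
  have := re_exp_pos z hz
  simp only [add_re, one_re]; linarith

lemma V_ne (z : ℂ) (hz : |z.im| < 1) : 1 + exp (-z) ≠ 0 := by
  intro h
  have := V_re z hz
  rw [h] at this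
  simp at this
  linarith

lemma E_deriv (z : ℂ) : HasDerivAt (fun z => exp (-z)) (-exp (-z)) z := by
  simpa using (hasDerivAt_neg z).cexp

lemma v_deriv (z : ℂ) (hz : |z.im| < 1) : HasDerivAt v (v1 z) z := by
  have := ((E_deriv z).const_add 1).clog (Or.inl (by linarith [V_re z hz]))
  rwa [neg_div] at this

lemma v1_deriv (z : ℂ) (hz : |z.im| < 1) : HasDerivAt v1 (v2 z) z := by
  have := ((E_deriv z).div ((E_deriv z).const_add 1) (V_ne z hz)).neg
  refine this.congr_deriv ?_
  rw [v2]
  have := V_ne z hz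
  field_simp
  ring

lemma v2_deriv (z : ℂ) (hz : |z.im| < 1) : HasDerivAt v2 (v3 z) z := by
  have hne := V_ne z hz
  have := ((E_deriv z).div (((E_deriv z).const_add 1).pow 2) (pow_ne_zero 2 hne))
  refine this.congr_deriv ?_
  rw [v3]
  simp only [Pi.pow_apply]
  field_simp
  push_cast
  ring

lemma norm_E (z : ℂ) : ‖exp (-z)‖ = Real.exp (-z.re) := by
  rw [norm_exp]; simp

lemma v3_bound (z : ℂ) (hz : |z.im| < 1) (h0 : 0 ≤ z.re) : ‖v3 z‖ ≤ 4 / (1 + z.re) ^ 2 := by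
  have h1 : 1 ≤ ‖1 + exp (-z)‖ := by
    have := V_re z hz
    have := abs_re_le_norm (1 + exp (-z))
    have := le_abs_self (1 + exp (-z)).re
    linarith
  have h2 : ‖1 - exp (-z)‖ ≤ 2 := by
    refine (norm_sub_le _ _).trans ?_
    rw [norm_E, norm_one]
    have : Real.exp (-z.re) ≤ 1 := by simpa using h0
    linarith
  have h3 := exp_bound z.re h0
  rw [v3, norm_neg, norm_div, norm_mul, norm_pow, norm_E]
  have h4 : 1 ≤ ‖1 + exp (-z)‖ ^ 3 := one_le_pow₀ h1
  calc _ ≤ Real.exp (-z.re) * ‖1 - exp (-z)‖ / 1 := by gcongr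
    _ ≤ 2 / (1 + z.re) ^ 2 * 2 / 1 := by gcongr
    _ = _ := by ring

/-! ### the function `log ((1 - e^{-z})/z)` -/

noncomputable def P (z : ℂ) : ℂ := dslope (fun z => 1 - exp (-z)) 0 z

lemma P_mul (z : ℂ) : z * P z = 1 - exp (-z) := by
  have := sub_smul_dslope (fun z => 1 - exp (-z)) 0 z
  simpa [P] using this

lemma P_diff : Differentiable ℂ P := by
  have : DifferentiableOn ℂ (dslope (fun z => 1 - exp (-z)) 0) Set.univ := by
    rw [Complex.differentiableOn_dslope univ_mem]
    fun_prop
  exact differentiableOn_univ.1 this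

lemma P_zero : P 0 = 1 := by
  rw [P, dslope_same]
  have := ((E_deriv 0).const_sub 1).deriv
  simpa using this

lemma P_deriv_rel (z : ℂ) : P z + z * deriv P z = exp (-z) := by
  have h1 : HasDerivAt (fun z => z * P z) (1 * P z + z * deriv P z) z :=
    (hasDerivAt_id z).mul (P_diff z).hasDerivAt
  have h2 : HasDerivAt (fun z => z * P z) (- -exp (-z)) z := by
    have := (E_deriv z).const_sub 1
    exact this.congr_of_eventuallyEq (Eventually.of_forall P_mul)
  have := h1.unique h2
  simpa using this

lemma P_deriv_zero : deriv P 0 = -(1 / 2) := by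
  have hd : Differentiable ℂ (deriv P) := by
    have := P_diff.differentiableOn.deriv isOpen_univ
    exact differentiableOn_univ.1 this
  have h1 : HasDerivAt (fun z => P z + z * deriv P z)
      (deriv P 0 + (1 * deriv P 0 + 0 * deriv (deriv P) 0)) 0 :=
    (P_diff 0).hasDerivAt.add ((hasDerivAt_id (0 : ℂ)).mul (hd 0).hasDerivAt)
  have h2 : HasDerivAt (fun z => P z + z * deriv P z) (-exp (-0)) 0 :=
    (E_deriv 0).congr_of_eventuallyEq (Eventually.of_forall P_deriv_rel)
  have := h1.unique h2
  simp at this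
  linear_combination this / 2

lemma P_re (z : ℂ) (hz : |z.im| < 1) : 0 < (P z).re := by
  by_cases h0 : z = 0
  · rw [h0, P_zero]; simp
  have hP : P z = ∫ x in (0:ℝ)..1, exp (-z * x) := by
    rw [integral_exp_mul_complex (neg_ne_zero.2 h0)]
    have := P_mul z
    field_simp
    simp
    linear_combination this
  have hI : IntervalIntegrable (fun x : ℝ => exp (-z * x)) MeasureTheory.volume 0 1 := by
    apply Continuous.intervalIntegrable
    fun_prop
  have : (P z).re = ∫ x in (0:ℝ)..1, (exp (-z * x)).re := by
    rw [hP]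
    exact (reCLM.intervalIntegral_comp_comm hI).symm
  rw [this]
  refine intervalIntegral.intervalIntegral_pos_of_pos_on ?_ ?_ one_pos
  · apply Continuous.intervalIntegrable
    fun_prop
  · intro x hx
    rw [neg_mul]
    apply re_exp_pos
    simp only [mul_im, ofReal_im, ofReal_re, mul_zero, zero_add, abs_mul, abs_of_pos hx.1]
    nlinarith [abs_nonneg z.im, hx.1, hx.2]

lemma P_ne (z : ℂ) (hz : |z.im| < 1) : P z ≠ 0 := by
  intro h
  have := P_re z hz
  rw [h] at this
  simp at this

noncomputable def g (z : ℂ) : ℂ := log (P z)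
noncomputable def g1 (z : ℂ) : ℂ := deriv P z / P z
noncomputable def g2 (z : ℂ) : ℂ := deriv g1 z
noncomputable def g3 (z : ℂ) : ℂ := deriv g2 z

lemma g_deriv (z : ℂ) (hz : |z.im| < 1) : HasDerivAt g (g1 z) z :=
  (P_diff z).hasDerivAt.clog (Or.inl (P_re z hz))

def strip : Set ℂ := {z | |z.im| < 1}

lemma strip_open : IsOpen strip :=
  isOpen_lt (by fun_prop) continuous_const

lemma g1_diffOn : DifferentiableOn ℂ g1 strip := by
  have hd : Differentiable ℂ (deriv P) := by
    have := P_diff.differentiableOn.deriv isOpen_univ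
    exact differentiableOn_univ.1 this
  exact hd.differentiableOn.div P_diff.differentiableOn (fun z hz => P_ne z hz)

lemma g2_diffOn : DifferentiableOn ℂ g2 strip := g1_diffOn.deriv strip_open
lemma g3_diffOn : DifferentiableOn ℂ g3 strip := g2_diffOn.deriv strip_open

lemma g1_deriv (z : ℂ) (hz : |z.im| < 1) : HasDerivAt g1 (g2 z) z :=
  (g1_diffOn.differentiableAt (strip_open.mem_nhds hz)).hasDerivAt

lemma g2_deriv (z : ℂ) (hz : |z.im| < 1) : HasDerivAt g2 (g3 z) z :=
  (g2_diffOn.differentiableAt (strip_open.mem_nhds hz)).hasDerivAt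

lemma one_sub_E_ne (z : ℂ) (hz : 0 < z.re) : 1 - exp (-z) ≠ 0 := by
  intro h
  have h1 : exp (-z) = 1 := (sub_eq_zero.1 h).symm
  have h2 := norm_E z
  rw [h1, norm_one] at h2
  have : Real.exp (-z.re) < 1 := by simpa using hz
  linarith

lemma re_ne (z : ℂ) (hz : 0 < z.re) : z ≠ 0 := by
  rintro rfl; simp at hz

lemma g1_eq (z : ℂ) (hz : 0 < z.re) : g1 z = exp (-z) / (1 - exp (-z)) - 1 / z := by
  have h0 := re_ne z hz
  have h1 := one_sub_E_ne z hz
  have h2 := P_mul z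
  have hP : P z ≠ 0 := by
    intro h; rw [h, mul_zero] at h2; exact h1 h2.symm
  have h3 := P_deriv_rel z
  rw [g1, ← h2]
  field_simp
  linear_combination h3

lemma halfplane_nhds (z : ℂ) (hz : 0 < z.re) : ∀ᶠ w in 𝓝 z, 0 < w.re :=
  (isOpen_lt continuous_const continuous_re).mem_nhds hz

lemma g2_eq (z : ℂ) (hz : 0 < z.re) :
    g2 z = -(exp (-z) / (1 - exp (-z)) ^ 2) + 1 / z ^ 2 := by
  have h0 := re_ne z hz
  have h1 := one_sub_E_ne z hz
  have hev : g1 =ᶠ[𝓝 z] fun z => exp (-z) / (1 - exp (-z)) - 1 / z :=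
    (halfplane_nhds z hz).mono g1_eq
  rw [g2, hev.deriv_eq]
  have := ((E_deriv z).div ((E_deriv z).const_sub 1) h1).sub
    ((hasDerivAt_const z (1:ℂ)).div (hasDerivAt_id z) h0)
  refine (this.congr_deriv ?_).deriv
  simp only [id]
  field_simp
  ring

lemma g3_eq (z : ℂ) (hz : 0 < z.re) :
    g3 z = exp (-z) * (1 + exp (-z)) / (1 - exp (-z)) ^ 3 - 2 / z ^ 3 := by
  have h0 := re_ne z hz
  have h1 := one_sub_E_ne z hz
  have hev : g2 =ᶠ[𝓝 z] fun z => -(exp (-z) / (1 - exp (-z)) ^ 2) + 1 / z ^ 2 :=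
    (halfplane_nhds z hz).mono g2_eq
  rw [g3, hev.deriv_eq]
  have := ((E_deriv z).div (((E_deriv z).const_sub 1).pow 2) (pow_ne_zero 2 h1)).neg.add
    ((hasDerivAt_const z (1:ℂ)).div ((hasDerivAt_id z).pow 2) (pow_ne_zero 2 h0))
  refine (this.congr_deriv ?_).deriv
  simp only [id, Pi.pow_apply]
  field_simp
  push_cast
  ring

lemma g3_bound_large (z : ℂ) (hz : 1 ≤ z.re) : ‖g3 z‖ ≤ 32 / (1 + z.re) ^ 2 := by
  have hE : ‖exp (-z)‖ ≤ 1 / 2 := by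
    rw [norm_E, Real.exp_neg, inv_eq_one_div]
    have := Real.add_one_le_exp z.re
    gcongr
    linarith
  have hE2 : ‖exp (-z)‖ ≤ 2 / (1 + z.re) ^ 2 := by
    rw [norm_E]; exact exp_bound _ (by linarith)
  have h1 : 1 / 2 ≤ ‖1 - exp (-z)‖ := by
    have := norm_sub_norm_le 1 (exp (-z))
    rw [norm_one] at this
    linarith
  have h2 : ‖1 + exp (-z)‖ ≤ 3 / 2 := by
    have := norm_add_le 1 (exp (-z))
    rw [norm_one] at this
    linarith
  have h3 : z.re ≤ ‖z‖ := re_le_norm z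
  rw [g3_eq z (by linarith)]
  refine (norm_sub_le _ _).trans ?_
  rw [norm_div, norm_div, norm_mul, norm_pow, norm_pow]
  have a1 : ‖exp (-z)‖ * ‖1 + exp (-z)‖ / ‖1 - exp (-z)‖ ^ 3 ≤ 24 / (1 + z.re) ^ 2 := by
    calc _ ≤ 2 / (1 + z.re) ^ 2 * (3 / 2) / (1 / 2) ^ 3 := by gcongr
      _ = _ := by ring
  have a2 : ‖(2:ℂ)‖ / ‖z‖ ^ 3 ≤ 8 / (1 + z.re) ^ 2 := by
    rw [div_le_div_iff₀ (by have : 0 < ‖z‖ := by linarith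
                            positivity) (by positivity)]
    have e : ‖(2:ℂ)‖ = 2 := by simp
    rw [e]
    have b1 : (1 + z.re) ^ 2 ≤ (2 * ‖z‖) ^ 2 := by gcongr; linarith
    have b2 : ‖z‖ ^ 2 ≤ ‖z‖ ^ 3 := pow_le_pow_right₀ (by linarith) (by norm_num)
    nlinarith
  calc _ ≤ 24 / (1 + z.re) ^ 2 + 8 / (1 + z.re) ^ 2 := add_le_add a1 a2
    _ = _ := by ring

lemma g3_bound : ∃ C : ℝ, 4 ≤ C ∧ ∀ z : ℂ, |z.im| ≤ 1 / 2 → 0 ≤ z.re →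
    ‖g3 z‖ ≤ C / (1 + z.re) ^ 2 := by
  have hc : IsCompact (Set.Icc (0:ℝ) 1 ×ℂ Set.Icc (-(1/2) : ℝ) (1/2)) :=
    isCompact_Icc.reProdIm isCompact_Icc
  obtain ⟨C, hC⟩ := hc.exists_bound_of_continuousOn (f := g3) (g3_diffOn.continuousOn.mono (by
    intro z hz
    have h := hz.2
    simp only [Set.mem_preimage, Set.mem_Icc] at h
    show |z.im| < 1
    rw [abs_lt]; constructor <;> linarith [h.1, h.2]))
  refine ⟨max 32 (4 * C), le_trans (by norm_num) (le_max_left _ _), fun z hz h0 => ?_⟩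
  by_cases h1 : 1 ≤ z.re
  · refine (g3_bound_large z h1).trans ?_
    gcongr
    exact le_max_left _ _
  · have := hC z ⟨⟨h0, by linarith⟩, abs_le.1 hz⟩
    refine this.trans ?_
    rw [le_div_iff₀ (by positivity)]
    have hC0 : 0 ≤ C := (norm_nonneg _).trans this
    refine le_trans ?_ (le_max_right _ _)
    have : (1 + z.re) ^ 2 ≤ 2 ^ 2 := by gcongr; linarith
    nlinarith

lemma w1_zero : g1 0 - v1 0 = 0 := by
  rw [g1, v1, P_zero, P_deriv_zero]
  norm_num

lemma tendsto_E : Tendsto (fun t : ℝ => exp (-(t : ℂ))) atTop (𝓝 0) := by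
  rw [tendsto_zero_iff_norm_tendsto_zero]
  simp only [norm_E, ofReal_re]
  exact Real.tendsto_exp_neg_atTop_nhds_zero

lemma w1_tendsto : Tendsto (fun t : ℝ => g1 t - v1 t) atTop (𝓝 0) := by
  have h1 : Tendsto (fun t : ℝ => exp (-(t : ℂ)) / (1 - exp (-(t:ℂ))) - 1 / (t:ℂ)) atTop
      (𝓝 (0 / (1 - 0) - 0)) := by
    refine (tendsto_E.div (tendsto_const_nhds.sub tendsto_E) (by simp)).sub ?_
    simp only [one_div]
    have := (continuous_ofReal.tendsto 0).comp tendsto_inv_atTop_zero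
    simpa [Function.comp_def] using this
  have h2 : Tendsto (fun t : ℝ => v1 t) atTop (𝓝 (-(0 / (1 + 0)))) :=
    (tendsto_E.div (tendsto_const_nhds.add tendsto_E) (by simp)).neg
  have := h1.sub h2
  simp only [zero_div, neg_zero, sub_zero] at this
  refine this.congr' ?_
  filter_upwards [eventually_gt_atTop 0] with t ht
  rw [g1_eq _ (by simpa using ht)]

lemma seg_mem (t m h : ℝ) (x : ℂ) (h0 : 0 ≤ h) (hx : ‖x‖ ≤ m) (hxr : 0 ≤ x.re)
    (hmh : m * h ≤ 1 / 2) (y : ℂ) (hy : y ∈ segment ℝ (t : ℂ) (t + x * h)) :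
    |y.im| ≤ 1 / 2 ∧ t ≤ y.re := by
  obtain ⟨θ, hθ, rfl⟩ := (segment_eq_image' ℝ (t : ℂ) (t + x * h)).subset hy
  simp only [add_sub_cancel_left, add_im, ofReal_im, zero_add, add_re, ofReal_re, real_smul,
    mul_im, mul_re, mul_zero, sub_zero, zero_mul, add_zero]
  constructor
  · rw [abs_mul, abs_mul, abs_of_nonneg hθ.1, abs_of_nonneg h0]
    have h1 := (abs_im_le_norm x).trans hx
    have h2 : |x.im| * h ≤ m * h := by gcongr
    have h3 : 0 ≤ |x.im| * h := by positivity
    nlinarith [hθ.1, hθ.2]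
  · have : 0 ≤ θ * (x.re * h) := mul_nonneg hθ.1 (mul_nonneg hxr h0)
    linarith

lemma pt_bound (u u1 u2 u3 : ℂ → ℂ) (C : ℝ) (hC : 0 ≤ C)
    (h1 : ∀ z : ℂ, |z.im| < 1 → HasDerivAt u (u1 z) z)
    (h2 : ∀ z : ℂ, |z.im| < 1 → HasDerivAt u1 (u2 z) z)
    (h3 : ∀ z : ℂ, |z.im| < 1 → HasDerivAt u2 (u3 z) z)
    (hb : ∀ z : ℂ, |z.im| ≤ 1 / 2 → 0 ≤ z.re → ‖u3 z‖ ≤ C / (1 + z.re) ^ 2)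
    (t m h : ℝ) (x : ℂ) (ht : 0 ≤ t) (h0 : 0 ≤ h) (hx : ‖x‖ ≤ m) (hxr : 0 ≤ x.re)
    (hmh : m * h ≤ 1 / 2) :
    ‖u1 (t + x * h) - u1 t - x * h * u2 t‖ ≤ C / (1 + t) ^ 2 * (m * h) ^ 2 ∧
    ‖u (t + x * h) - u t - x * h * u1 t - (x * h) ^ 2 / 2 * u2 t‖ ≤
      C / (1 + t) ^ 2 * (m * h) ^ 3 := by
  have hs := seg_mem t m h x h0 hx hxr hmh
  have hlt : ∀ y ∈ segment ℝ (t : ℂ) (t + x * h), |y.im| < 1 := fun y hy =>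
    lt_of_le_of_lt (hs y hy).1 (by norm_num)
  obtain ⟨e1, e2⟩ := taylor u u1 u2 u3 t (x * h) (C / (1 + t) ^ 2)
    (fun y hy => h1 y (hlt y hy)) (fun y hy => h2 y (hlt y hy)) (fun y hy => h3 y (hlt y hy))
    (fun y hy => by
      obtain ⟨a1, a2⟩ := hs y hy
      refine (hb y a1 (by linarith)).trans ?_
      gcongr)
  have hn : ‖x * h‖ ≤ m * h := by
    rw [norm_mul, norm_real, Real.norm_eq_abs, abs_of_nonneg h0]; gcongr
  exact ⟨e1.trans (by gcongr), e2.trans (by gcongr)⟩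

noncomputable def L (a b : ℂ) (h t : ℝ) : ℂ :=
  g t + g (t + (a + b) * h) - g (t + a * h) - g (t + b * h) +
  v (t + (1 - a) * h) + v (t + (1 - b) * h) - v (t + 1 * h) - v (t + (1 - (a + b)) * h)

lemma L_bound : ∃ C : ℝ, 0 < C ∧ ∀ (a b : ℂ) (m h t : ℝ), 0 < a.re → 0 < b.re →
    (a + b).re < 1 → 1 ≤ m → ‖a‖ ≤ m → ‖b‖ ≤ m → ‖a + b‖ ≤ m → ‖1 - a‖ ≤ m → ‖1 - b‖ ≤ m →
    ‖1 - (a + b)‖ ≤ m → 0 < h → m * h ≤ 1 / 2 → 0 ≤ t →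
    ‖L a b h t - a * b * h * ((g1 (t + 1 * h) - v1 (t + 1 * h)) - (g1 t - v1 t))‖ ≤
      C * m ^ 4 * h ^ 3 * (1 / (1 + t) ^ 2) := by
  obtain ⟨C, hC4, hC⟩ := g3_bound
  have hv : ∀ z : ℂ, |z.im| ≤ 1 / 2 → 0 ≤ z.re → ‖v3 z‖ ≤ C / (1 + z.re) ^ 2 := by
    intro z hz h0
    refine (v3_bound z (lt_of_le_of_lt hz (by norm_num)) h0).trans ?_
    gcongr
  refine ⟨9 * C, by linarith, ?_⟩
  intro a b m h t ha hb hs hm na nb ns na' nb' ns' h0 hmh ht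
  have hC0 : 0 ≤ C := by linarith
  have G := fun x hx hxr => pt_bound g g1 g2 g3 C hC0 g_deriv g1_deriv g2_deriv hC t m h x ht h0.le
    hx hxr hmh
  have V := fun x hx hxr => pt_bound v v1 v2 v3 C hC0 v_deriv v1_deriv v2_deriv hv t m h x ht h0.le
    hx hxr hmh
  simp only [add_re] at hs
  have G_s := (G (a + b) ns (by simp only [add_re]; linarith)).2
  have G_a := (G a na ha.le).2
  have G_b := (G b nb hb.le).2
  have V_a := (V (1 - a) na' (by simp only [sub_re, one_re]; linarith)).2
  have V_b := (V (1 - b) nb' (by simp only [sub_re, one_re]; linarith)).2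
  have V_s := (V (1 - (a + b)) ns' (by simp only [sub_re, one_re, add_re]; linarith)).2
  have V_1 := (V 1 (by simpa using hm) (by simp)).2
  have V_1' := (V 1 (by simpa using hm) (by simp)).1
  have G_1' := (G 1 (by simpa using hm) (by simp)).1
  set D := C / (1 + t) ^ 2 with hD
  have hD0 : 0 ≤ D := by positivity
  have id : L a b h t - a * b * h * ((g1 (t + 1 * h) - v1 (t + 1 * h)) - (g1 t - v1 t)) =
      (g (t + (a + b) * h) - g t - (a + b) * h * g1 t - ((a + b) * h) ^ 2 / 2 * g2 t) -
      (g (t + a * h) - g t - a * h * g1 t - (a * h) ^ 2 / 2 * g2 t) -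
      (g (t + b * h) - g t - b * h * g1 t - (b * h) ^ 2 / 2 * g2 t) +
      (v (t + (1 - a) * h) - v t - (1 - a) * h * v1 t - ((1 - a) * h) ^ 2 / 2 * v2 t) +
      (v (t + (1 - b) * h) - v t - (1 - b) * h * v1 t - ((1 - b) * h) ^ 2 / 2 * v2 t) -
      (v (t + 1 * h) - v t - 1 * h * v1 t - (1 * h) ^ 2 / 2 * v2 t) -
      (v (t + (1 - (a + b)) * h) - v t - (1 - (a + b)) * h * v1 t -
        ((1 - (a + b)) * h) ^ 2 / 2 * v2 t) -
      a * b * h * (g1 (t + 1 * h) - g1 t - 1 * h * g2 t) +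
      a * b * h * (v1 (t + 1 * h) - v1 t - 1 * h * v2 t) := by
    rw [L]; ring
  have habh : ‖a * b * h‖ ≤ m * m * h := by
    rw [norm_mul, norm_mul, norm_real, Real.norm_eq_abs, abs_of_nonneg h0.le]; gcongr
  have e1 : ‖a * b * h * (g1 (t + 1 * h) - g1 t - 1 * h * g2 t)‖ ≤
      m * m * h * (D * (m * h) ^ 2) := by rw [norm_mul]; gcongr
  have e2 : ‖a * b * h * (v1 (t + 1 * h) - v1 t - 1 * h * v2 t)‖ ≤
      m * m * h * (D * (m * h) ^ 2) := by rw [norm_mul]; gcongr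
  rw [id]
  have hfin : 7 * (D * (m * h) ^ 3) + 2 * (m * m * h * (D * (m * h) ^ 2)) ≤
      9 * C * m ^ 4 * h ^ 3 * (1 / (1 + t) ^ 2) := by
    have : 9 * C * m ^ 4 * h ^ 3 * (1 / (1 + t) ^ 2) = 9 * (D * h ^ 3) * m ^ 4 := by
      rw [hD]; ring
    rw [this]
    have h34 : m ^ 3 ≤ m ^ 4 := pow_le_pow_right₀ hm (by norm_num)
    have : 0 ≤ D * h ^ 3 := by positivity
    nlinarith [mul_le_mul_of_nonneg_left h34 this]
  refine le_trans ?_ hfin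
  refine (norm_add_le _ _).trans ?_
  refine (add_le_add (norm_sub_le _ _) le_rfl).trans ?_
  refine (add_le_add (add_le_add (norm_sub_le _ _) le_rfl) le_rfl).trans ?_
  refine (add_le_add (add_le_add (add_le_add (norm_sub_le _ _) le_rfl) le_rfl) le_rfl).trans ?_
  refine (add_le_add (add_le_add (add_le_add (add_le_add (norm_add_le _ _) le_rfl) le_rfl) le_rfl)
    le_rfl).trans ?_
  refine (add_le_add (add_le_add (add_le_add (add_le_add (add_le_add (norm_add_le _ _) le_rfl)
    le_rfl) le_rfl) le_rfl) le_rfl).trans ?_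
  refine (add_le_add (add_le_add (add_le_add (add_le_add (add_le_add (add_le_add (norm_sub_le _ _)
    le_rfl) le_rfl) le_rfl) le_rfl) le_rfl) le_rfl).trans ?_
  refine (add_le_add (add_le_add (add_le_add (add_le_add (add_le_add (add_le_add (add_le_add
    (norm_sub_le _ _) le_rfl) le_rfl) le_rfl) le_rfl) le_rfl) le_rfl) le_rfl).trans ?_
  linarith

/-- the partial sums of `L` -/
lemma sum_L_bound : ∃ C : ℝ, 0 < C ∧ ∀ (a b : ℂ) (m h : ℝ), 0 < a.re → 0 < b.re →
    (a + b).re < 1 → 1 ≤ m → ‖a‖ ≤ m → ‖b‖ ≤ m → ‖a + b‖ ≤ m → ‖1 - a‖ ≤ m → ‖1 - b‖ ≤ m →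
    ‖1 - (a + b)‖ ≤ m → 0 < h → m * h ≤ 1 / 2 → ∀ N : ℕ,
    ‖∑ n ∈ Finset.range N, L a b h (n * h) -
      a * b * h * (g1 ((N * h : ℝ) : ℂ) - v1 ((N * h : ℝ) : ℂ))‖ ≤ C * m ^ 4 * h ^ 2 := by
  obtain ⟨C, hC0, hC⟩ := L_bound
  refine ⟨2 * C, by linarith, ?_⟩
  intro a b m h ha hb hs hm na nb ns na' nb' ns' h0 hmh N
  have key := fun n : ℕ => hC a b m h (n * h) ha hb hs hm na nb ns na' nb' ns' h0 hmh (by positivity)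
  have tel : a * b * h * (g1 ((N * h : ℝ) : ℂ) - v1 ((N * h : ℝ) : ℂ)) =
      ∑ n ∈ Finset.range N, a * b * h *
        ((g1 (((n * h : ℝ) : ℂ) + 1 * h) - v1 (((n * h : ℝ) : ℂ) + 1 * h)) -
          (g1 ((n * h : ℝ) : ℂ) - v1 ((n * h : ℝ) : ℂ))) := by
    rw [← Finset.mul_sum]
    congr 1
    have := Finset.sum_range_sub (fun n : ℕ => g1 ((n * h : ℝ) : ℂ) - v1 ((n * h : ℝ) : ℂ)) N
    simp only [Nat.cast_zero, zero_mul, ofReal_zero, w1_zero, sub_zero] at this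
    rw [← this]
    refine Finset.sum_congr rfl fun n _ => ?_
    have : (((n + 1 : ℕ) * h : ℝ) : ℂ) = ((n * h : ℝ) : ℂ) + 1 * h := by push_cast; ring
    rw [this]
  rw [tel, ← Finset.sum_sub_distrib]
  refine (norm_sum_le _ _).trans ?_
  refine (Finset.sum_le_sum fun n _ => key n).trans ?_
  rw [← Finset.mul_sum]
  have hh : h ≤ 1 := by nlinarith
  have := sum_bound h h0 hh N
  calc _ ≤ C * m ^ 4 * h ^ 3 * (2 / h) := by gcongr
    _ = _ := by field_simp

/-! ### infinite products -/

lemma summ (z q : ℂ) (hq : ‖q‖ < 1) : Summable fun n : ℕ => ‖-(q ^ n * z)‖ := by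
  simp only [norm_neg, norm_mul, norm_pow]
  exact (summable_geometric_of_lt_one (norm_nonneg _) hq).mul_right _

lemma qP_mult (z q : ℂ) (hq : ‖q‖ < 1) : Multipliable fun n : ℕ => (1 - q ^ n * z) := by
  simpa [sub_eq_add_neg] using multipliable_one_add_of_summable (summ z q hq)

lemma qP_tendsto (z q : ℂ) (hq : ‖q‖ < 1) :
    Tendsto (fun N => ∏ n ∈ Finset.range N, (1 - q ^ n * z)) atTop (𝓝 (qPochInf z q)) :=
  (qP_mult z q hq).hasProd.tendsto_prod_nat

lemma qP_ne (z q : ℂ) (hq : ‖q‖ < 1) (hz : ‖z‖ < 1) : qPochInf z q ≠ 0 := by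
  have := tprod_one_add_ne_zero_of_summable (f := fun n : ℕ => -(q ^ n * z)) ?_ (summ z q hq)
  · simpa [sub_eq_add_neg, qPochInf] using this
  · intro n h
    have h1 : q ^ n * z = 1 := by linear_combination -h
    have h2 : ‖q ^ n * z‖ < 1 := by
      rw [norm_mul, norm_pow]
      have : ‖q‖ ^ n ≤ 1 := pow_le_one₀ (norm_nonneg _) hq.le
      nlinarith [norm_nonneg z, norm_nonneg q]
    rw [h1, norm_one] at h2
    exact lt_irrefl _ h2

lemma qP_sq (q : ℂ) (hq : ‖q‖ < 1) :
    qPochInf (q ^ 2) (q ^ 2) = qPochInf q q * qPochInf (-q) q := by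
  rw [qPochInf, qPochInf, qPochInf, ← (qP_mult q q hq).tprod_mul (qP_mult (-q) q hq)]
  refine tprod_congr fun n => ?_
  ring

lemma cq_eq (q : ℂ) (hq : ‖q‖ < 1) : cq q = qPochInf q q / qPochInf (-q) q := by
  rw [cq, qP_sq q hq]
  by_cases h : qPochInf q q = 0
  · simp [h]
  · rw [pow_two, mul_div_mul_left _ _ h]

/-- `q^x` -/
noncomputable def e (h : ℝ) (x : ℂ) : ℂ := exp (-(x * h))

noncomputable def X (a b : ℂ) (h : ℝ) : ℂ :=
  qPochInf (e h 1) (e h 1) * qPochInf (e h (a + b)) (e h 1) /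
    (qPochInf (e h a) (e h 1) * qPochInf (e h b) (e h 1)) *
  (qPochInf (-e h (1 - a)) (e h 1) * qPochInf (-e h (1 - b)) (e h 1) /
    (qPochInf (-e h 1) (e h 1) * qPochInf (-e h (1 - (a + b))) (e h 1)))

lemma e_norm (h : ℝ) (x : ℂ) (h0 : 0 < h) (hx : 0 < x.re) : ‖e h x‖ < 1 := by
  rw [e, norm_E]
  simp
  positivity

lemma e_mul (h : ℝ) (x y : ℂ) : e h x * e h y = e h (x + y) := by
  rw [e, e, e, ← exp_add]; congr 1; ring

lemma e_inv (h : ℝ) (x : ℂ) : (e h x)⁻¹ = e h (-x) := by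
  rw [e, e, ← exp_neg]; congr 1; ring

lemma fGK_eq (A A' : ℂ) (κ : ℝ) (hκ : 0 < κ) :
    fGK A A' (1 - A - A') κ = X A' (1 - A - A') κ⁻¹ := by
  have e1 : exp (-1 / (κ : ℂ)) = e κ⁻¹ 1 := by
    rw [e]; congr 1; push_cast; ring
  have e2 : ∀ x : ℂ, exp (x * (-1 / (κ : ℂ))) = e κ⁻¹ x := by
    intro x; rw [e]; congr 1; push_cast; ring
  have hq := e_norm κ⁻¹ 1 (inv_pos.2 hκ) (by simp)
  rw [fGK, e1, cq_eq _ hq]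
  simp only [e2, Gq, X]
  have r1 : -e κ⁻¹ 1 * (-e κ⁻¹ A)⁻¹ = e κ⁻¹ (A' + (1 - A - A')) := by
    rw [inv_neg, e_inv, neg_mul_neg, e_mul]; congr 1; ring
  have r2 : ∀ x, -e κ⁻¹ 1 * (e κ⁻¹ x)⁻¹ = -e κ⁻¹ (1 - x) := by
    intro x
    rw [e_inv, neg_mul, e_mul]; congr 1
  have r3 : (1 - (A' + (1 - A - A'))) = A := by ring
  rw [r1, r2, r2, r3]
  generalize qPochInf _ _ = x1
  simp only [div_eq_mul_inv, mul_inv]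
  ring

lemma exp_g (z : ℂ) (hz : |z.im| < 1) : exp (g z) = P z := exp_log (P_ne z hz)
lemma exp_v (z : ℂ) (hz : |z.im| < 1) : exp (v z) = 1 + exp (-z) := exp_log (V_ne z hz)

lemma im_small (t m h : ℝ) (x : ℂ) (h0 : 0 < h) (hx : ‖x‖ ≤ m) (hmh : m * h ≤ 1 / 2) :
    |(t + x * h : ℂ).im| < 1 := by
  have e : (t + x * h : ℂ).im = x.im * h := by simp
  rw [e, abs_mul, abs_of_pos h0]
  have h1 := (abs_im_le_norm x).trans hx
  have h2 : |x.im| * h ≤ m * h := by gcongr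
  linarith

lemma exp_L (a b : ℂ) (m h t : ℝ) (hm : 1 ≤ m) (na : ‖a‖ ≤ m) (nb : ‖b‖ ≤ m) (ns : ‖a + b‖ ≤ m)
    (na' : ‖1 - a‖ ≤ m) (nb' : ‖1 - b‖ ≤ m) (ns' : ‖1 - (a + b)‖ ≤ m) (h0 : 0 < h)
    (hmh : m * h ≤ 1 / 2) :
    exp (L a b h t) = P t * P (t + (a + b) * h) / (P (t + a * h) * P (t + b * h)) *
      ((1 + exp (-(t + (1 - a) * h))) * (1 + exp (-(t + (1 - b) * h))) /
      ((1 + exp (-(t + 1 * h))) * (1 + exp (-(t + (1 - (a + b)) * h))))) := by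
  have I := fun x hx => im_small t m h x h0 hx hmh
  rw [L, exp_sub, exp_sub, exp_add, exp_add, exp_sub, exp_sub, exp_add,
    exp_g _ (I _ ns), exp_g _ (I _ na), exp_g _ (I _ nb), exp_g t (by simp),
    exp_v _ (I _ na'), exp_v _ (I _ nb'), exp_v _ (I _ ns'), exp_v _ (I 1 (by simpa using hm))]
  simp only [div_eq_mul_inv, mul_inv]
  ring

lemma fac_e (h : ℝ) (n : ℕ) (x : ℂ) : e h 1 ^ n * e h x = exp (-(((n * h : ℝ) : ℂ) + x * h)) := by
  rw [e, e, ← exp_nat_mul, ← exp_add]; congr 1; push_cast; ring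

lemma prod_P (h : ℝ) (hh : h ≠ 0) (x : ℂ) (hx : 0 < x.re) (N : ℕ) :
    ∏ n ∈ Finset.range N, P (((n * h : ℝ) : ℂ) + x * h) =
      (∏ n ∈ Finset.range N, (1 - e h 1 ^ n * e h x)) /
        ((h : ℂ) ^ N * ∏ n ∈ Finset.range N, (x + n)) := by
  have hc : (h : ℂ) ^ N = ∏ n ∈ Finset.range N, (h : ℂ) := by simp
  rw [hc, ← Finset.prod_mul_distrib, ← Finset.prod_div_distrib]
  refine Finset.prod_congr rfl fun n _ => ?_
  rw [fac_e, ← P_mul]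
  have h1 : (h : ℂ) ≠ 0 := by exact_mod_cast hh
  have h2 : x + n ≠ 0 := re_ne _ (by simp; positivity)
  field_simp
  push_cast
  ring

lemma prod_P0 (h : ℝ) (hh : h ≠ 0) (k : ℕ) :
    ∏ n ∈ Finset.range (k + 1), P ((n * h : ℝ) : ℂ) =
      (∏ n ∈ Finset.range k, (1 - e h 1 ^ n * e h 1)) / ((h : ℂ) ^ k * (k.factorial : ℂ)) := by
  rw [Finset.prod_range_succ']
  simp only [Nat.cast_zero, zero_mul, ofReal_zero, P_zero, mul_one]
  have := prod_P h hh 1 (by simp) k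
  have e1 : ∏ n ∈ Finset.range k, ((1 : ℂ) + n) = (k.factorial : ℂ) := by
    rw [← Finset.prod_range_add_one_eq_factorial]
    push_cast
    exact Finset.prod_congr rfl fun n _ => by ring
  rw [e1] at this
  rw [← this]
  refine Finset.prod_congr rfl fun n _ => ?_
  congr 1
  push_cast
  ring

lemma prod_tendsto (a b : ℂ) (m h : ℝ) (ha : 0 < a.re) (hb : 0 < b.re) (hs : (a + b).re < 1)
    (hm : 1 ≤ m) (na : ‖a‖ ≤ m) (nb : ‖b‖ ≤ m) (ns : ‖a + b‖ ≤ m)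
    (na' : ‖1 - a‖ ≤ m) (nb' : ‖1 - b‖ ≤ m) (ns' : ‖1 - (a + b)‖ ≤ m) (h0 : 0 < h)
    (hmh : m * h ≤ 1 / 2) :
    Tendsto (fun k : ℕ => exp (∑ n ∈ Finset.range (k + 1), L a b h (n * h))) atTop
      (𝓝 (X a b h * (h / betaC a b))) := by
  have hsr : 0 < (a + b).re := by simp only [add_re]; linarith
  have hq := e_norm h 1 h0 (by simp)
  have T := fun z => (qP_tendsto z (e h 1) hq).comp (tendsto_add_atTop_nat 1)
  have T0 := qP_tendsto (e h 1) (e h 1) hq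
  have N1 := qP_ne _ _ hq (e_norm h a h0 ha)
  have N2 := qP_ne _ _ hq (e_norm h b h0 hb)
  have N3 := qP_ne (-e h 1) _ hq (by rw [norm_neg]; exact hq)
  have N4 := qP_ne (-e h (1 - (a + b))) _ hq (by
    rw [norm_neg]; exact e_norm h _ h0 (by simp only [sub_re, one_re]; linarith))
  have Gs := GammaSeq_tendsto_Gamma (a + b)
  have Ga := GammaSeq_tendsto_Gamma a
  have Gb := GammaSeq_tendsto_Gamma b
  have Na := Gamma_ne_zero_of_re_pos ha
  have Nb := Gamma_ne_zero_of_re_pos hb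
  have big := ((T0.mul (T (e h (a + b)))).div ((T (e h a)).mul (T (e h b))) (mul_ne_zero N1 N2)).mul
    (((T (-e h (1 - a))).mul (T (-e h (1 - b)))).div
      ((T (-e h 1)).mul (T (-e h (1 - (a + b))))) (mul_ne_zero N3 N4))
  have big2 := big.mul ((tendsto_const_nhds (x := (h : ℂ))).mul
    (Gs.div (Ga.mul Gb) (mul_ne_zero Na Nb)))
  have hlim : X a b h * (h / betaC a b) = X a b h *
      (h * (Gamma (a + b) / (Gamma a * Gamma b))) := by
    rw [betaC, div_div_eq_mul_div, mul_div_assoc]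
  rw [hlim]
  refine big2.congr' ?_
  filter_upwards [eventually_ge_atTop 1] with k hk
  rw [exp_sum]
  have hL := fun n : ℕ => exp_L a b m h (n * h) hm na nb ns na' nb' ns' h0 hmh
  simp only [hL, Finset.prod_mul_distrib, Finset.prod_div_distrib]
  rw [prod_P0 h h0.ne', prod_P h h0.ne' _ ha, prod_P h h0.ne' _ hb, prod_P h h0.ne' _ hsr]
  have hV : ∀ x : ℂ, ∏ n ∈ Finset.range (k + 1), (1 + exp (-(((n * h : ℝ) : ℂ) + x * h))) =
      ∏ n ∈ Finset.range (k + 1), (1 - e h 1 ^ n * -e h x) := by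
    intro x
    refine Finset.prod_congr rfl fun n _ => ?_
    rw [← fac_e]; ring
  rw [hV, hV, hV, hV]
  simp only [Function.comp, Pi.div_apply]
  generalize ∏ n ∈ Finset.range (k + 1), (1 - e h 1 ^ n * -e h (1 - a)) = p1
  generalize ∏ n ∈ Finset.range (k + 1), (1 - e h 1 ^ n * -e h (1 - b)) = p2
  generalize ∏ n ∈ Finset.range (k + 1), (1 - e h 1 ^ n * -e h (1 - (a + b))) = p3
  generalize ∏ n ∈ Finset.range (k + 1), (1 - e h 1 ^ n * -e h 1) = p4
  generalize ∏ n ∈ Finset.range (k + 1), (1 - e h 1 ^ n * e h a) = p5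
  generalize ∏ n ∈ Finset.range (k + 1), (1 - e h 1 ^ n * e h b) = p6
  generalize ∏ n ∈ Finset.range (k + 1), (1 - e h 1 ^ n * e h (a + b)) = p7
  generalize ∏ n ∈ Finset.range k, (1 - e h 1 ^ n * e h 1) = p8
  rw [mul_right_comm]
  congr 1
  have hprod : ∀ x : ℂ, 0 < x.re → ∏ n ∈ Finset.range (k + 1), (x + n) ≠ 0 := by
    intro x hx
    exact Finset.prod_ne_zero_iff.2 fun n _ => re_ne _ (by simp; positivity)
  have q1 := hprod _ ha
  have q2 := hprod _ hb
  have q3 := hprod _ hsr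
  have hk0 : (k : ℂ) ≠ 0 := by exact_mod_cast (by lia : k ≠ 0)
  have c1 : (k : ℂ) ^ a ≠ 0 := by simp [cpow_eq_zero_iff, hk0]
  have c2 : (k : ℂ) ^ b ≠ 0 := by simp [cpow_eq_zero_iff, hk0]
  have hf : (k.factorial : ℂ) ≠ 0 := by exact_mod_cast k.factorial_ne_zero
  have hh : (h : ℂ) ≠ 0 := by exact_mod_cast h0.ne'
  simp only [GammaSeq, cpow_add _ _ hk0]
  generalize ∏ n ∈ Finset.range (k + 1), (a + b + (n : ℂ)) = r1 at *
  generalize ∏ n ∈ Finset.range (k + 1), (a + (n : ℂ)) = r2 at *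
  generalize ∏ n ∈ Finset.range (k + 1), (b + (n : ℂ)) = r3 at *
  have key : (h : ℂ) * ((k : ℂ) ^ a * (k : ℂ) ^ b * (k.factorial : ℂ) / r1 /
      ((k : ℂ) ^ a * (k.factorial : ℂ) / r2 * ((k : ℂ) ^ b * (k.factorial : ℂ) / r3))) =
      h * r2 * r3 / (k.factorial * r1) := by
    field_simp
  rw [key]
  have key2 : p8 / ((h : ℂ) ^ k * k.factorial) * (p7 / ((h : ℂ) ^ (k + 1) * r1)) /
      (p5 / ((h : ℂ) ^ (k + 1) * r2) * (p6 / ((h : ℂ) ^ (k + 1) * r3))) =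
      p8 * p7 / (p5 * p6) * (h * r2 * r3 / (k.factorial * r1)) := by
    rw [div_mul_div_comm, div_mul_div_comm, div_div_div_eq, div_mul_div_comm]
    have : (h : ℂ) ^ (k + 1) = h ^ k * h := pow_succ _ _
    rw [this]
    have hhk : (h : ℂ) ^ k ≠ 0 := pow_ne_zero _ hh
    generalize (h : ℂ) ^ k = hk' at *
    by_cases h5 : p5 = 0
    · simp [h5]
    by_cases h6 : p6 = 0
    · simp [h6]
    field_simp
  rw [key2]

end GKaux

open GKaux in
theorem stmt9 (K : Set (ℂ × ℂ)) (hK : IsCompact K)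
    (hKpos : ∀ p ∈ K, 0 < p.1.re ∧ 0 < p.2.re ∧ 0 < (1 - p.1 - p.2).re) :
    ∃ C R : ℝ, 0 < C ∧ 0 < R ∧ ∀ A A' : ℂ, (A, A') ∈ K → ∀ κ : ℝ, R ≤ κ →
      ‖fGK A A' (1 - A - A') κ - (κ : ℂ) * betaC A' (1 - A - A')‖ ≤
        C * ‖betaC A' (1 - A - A')‖ * κ⁻¹ := by
  obtain ⟨C, hC0, hC⟩ := sum_L_bound
  obtain ⟨M, hM⟩ := hK.isBounded.exists_norm_le
  set m : ℝ := 2 + 2 * |M| with hmdef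
  have hm1 : 1 ≤ m := by have := abs_nonneg M; linarith
  have hm0 : 0 < m := by linarith
  refine ⟨2 * (C * m ^ 4), 2 * m + 2 * (C * m ^ 4) + 1, by positivity, by positivity, ?_⟩
  intro A A' hAA κ hκ
  have hCm : 0 < C * m ^ 4 := by positivity
  have hκ0 : 0 < κ := by linarith
  obtain ⟨p1, p2, p3⟩ := hKpos _ hAA
  simp only at p1 p2 p3
  have hnorm := hM _ hAA
  have nA : ‖A‖ ≤ |M| := (norm_fst_le (A, A')).trans (hnorm.trans (le_abs_self M))
  have nA' : ‖A'‖ ≤ |M| := (norm_snd_le (A, A')).trans (hnorm.trans (le_abs_self M))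
  set b := 1 - A - A' with hbdef
  have hab : A' + b = 1 - A := by rw [hbdef]; ring
  have aM := abs_nonneg M
  have h1A : ‖1 - A‖ ≤ 1 + |M| := (norm_sub_le _ _).trans (by rw [norm_one]; linarith)
  have h1A' : ‖1 - A'‖ ≤ 1 + |M| := (norm_sub_le _ _).trans (by rw [norm_one]; linarith)
  have nb : ‖b‖ ≤ m := (norm_sub_le _ _).trans (by linarith)
  have n1b : ‖1 - b‖ ≤ m := by
    have : 1 - b = A + A' := by rw [hbdef]; ring
    rw [this]
    exact (norm_add_le _ _).trans (by linarith)
  have nab : ‖A' + b‖ ≤ m := by rw [hab]; linarith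
  have nab' : ‖1 - (A' + b)‖ ≤ m := by
    rw [hab, sub_sub_cancel]; linarith
  have hs : (A' + b).re < 1 := by rw [hab]; simp only [sub_re, one_re]; linarith
  have hh0 : 0 < κ⁻¹ := inv_pos.2 hκ0
  have hmh : m * κ⁻¹ ≤ 1 / 2 := by
    rw [← div_eq_mul_inv, div_le_iff₀ hκ0]; linarith
  have hsmall : C * m ^ 4 * κ⁻¹ ^ 2 ≤ 1 / 2 := by
    have h1 : κ⁻¹ ≤ 1 := inv_le_one_of_one_le₀ (by linarith)
    have h2 : C * m ^ 4 * κ⁻¹ ≤ 1 / 2 := by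
      rw [← div_eq_mul_inv, div_le_iff₀ hκ0]; linarith
    rw [pow_two, ← mul_assoc]
    nlinarith
  have T := prod_tendsto A' b m κ⁻¹ p2 p3 hs hm1 (by linarith) nb nab (by linarith) n1b nab' hh0 hmh
  have S := hC A' b m κ⁻¹ p2 p3 hs hm1 (by linarith) nb nab (by linarith) n1b nab' hh0 hmh
  have hW : Tendsto (fun k : ℕ => ‖A' * b * (κ⁻¹ : ℝ) *
      (g1 ((((k + 1 : ℕ) : ℝ) * κ⁻¹ : ℝ) : ℂ) - v1 ((((k + 1 : ℕ) : ℝ) * κ⁻¹ : ℝ) : ℂ))‖)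
      atTop (𝓝 0) := by
    have h1 : Tendsto (fun k : ℕ => ((k + 1 : ℕ) : ℝ) * κ⁻¹) atTop atTop :=
      Tendsto.atTop_mul_const hh0
        (tendsto_natCast_atTop_atTop.comp (tendsto_add_atTop_nat 1))
    have := ((w1_tendsto.comp h1).const_mul (A' * b * (κ⁻¹ : ℝ))).norm
    simpa [Function.comp_def] using this
  have main : ‖X A' b κ⁻¹ * ((κ⁻¹ : ℝ) / betaC A' b) - 1‖ ≤ 2 * (0 + C * m ^ 4 * κ⁻¹ ^ 2) := by
    refine le_of_tendsto_of_tendsto (T.sub_const 1).norm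
      ((hW.add_const (C * m ^ 4 * κ⁻¹ ^ 2)).const_mul 2) ?_
    filter_upwards [hW.eventually (gt_mem_nhds (by norm_num : (0:ℝ) < 1 / 2))] with k hk
    have hk2 := S (k + 1)
    have hle := norm_le_norm_add_norm_sub'
      (∑ n ∈ Finset.range (k + 1), L A' b κ⁻¹ (n * κ⁻¹)) (A' * b * (κ⁻¹ : ℝ) *
      (g1 ((((k + 1 : ℕ) : ℝ) * κ⁻¹ : ℝ) : ℂ) - v1 ((((k + 1 : ℕ) : ℝ) * κ⁻¹ : ℝ) : ℂ)))
    refine (norm_exp_sub_one_le (by linarith)).trans ?_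
    linarith
  have hB : betaC A' b ≠ 0 := by
    rw [betaC]
    refine div_ne_zero (mul_ne_zero (Gamma_ne_zero_of_re_pos p2) (Gamma_ne_zero_of_re_pos p3))
      (Gamma_ne_zero_of_re_pos ?_)
    simp only [add_re]; linarith
  have hκc : (κ : ℂ) ≠ 0 := by exact_mod_cast hκ0.ne'
  have hfin : fGK A A' b κ - κ * betaC A' b =
      κ * betaC A' b * (X A' b κ⁻¹ * ((κ⁻¹ : ℝ) / betaC A' b) - 1) := by
    rw [hbdef, fGK_eq A A' κ hκ0, ← hbdef]
    push_cast
    field_simp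
  rw [hfin, norm_mul, norm_mul, norm_real, Real.norm_eq_abs, abs_of_pos hκ0]
  calc _ ≤ κ * ‖betaC A' b‖ * (2 * (0 + C * m ^ 4 * κ⁻¹ ^ 2)) := by gcongr
    _ = _ := by field_simp; ring
end

section
/- Barnes' second lemma in beta-function form: for complex parameters A₁, A₂, A₃, B₁, B₂ with positive real parts, the principal-value contour integral (1/(2πi)) ∫_{−i∞}^{i∞} B(A₁+s, B₁−s)·B(A₂+s, B₂−s)·B(A₃+s, A₁+A₂+B₁+B₂) ds equals B(A₂+B₁, A₃+B₂)·B(A₁+B₂, A₃+B₁). -/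
open Filter

open MeasureTheory Set Complex

/-- Power of a positive real, written as an exponential. -/
noncomputable def pw (x : ℝ) (a : ℂ) : ℂ := cexp ((Real.log x : ℂ) * a)

lemma pw_eq {x : ℝ} (hx : 0 < x) (a : ℂ) : (x : ℂ) ^ a = pw x a := by
  rw [pw, cpow_def_of_ne_zero (by exact_mod_cast hx.ne'), ofReal_log hx.le]

lemma pw_add (x : ℝ) (a b : ℂ) : pw x (a + b) = pw x a * pw x b := by
  simp only [pw, mul_add, Complex.exp_add]

lemma pw_mul {x y : ℝ} (hx : 0 < x) (hy : 0 < y) (a : ℂ) : pw (x * y) a = pw x a * pw y a := by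
  simp only [pw, Real.log_mul hx.ne' hy.ne', ofReal_add, add_mul, Complex.exp_add]

lemma pw_div {x y : ℝ} (hx : 0 < x) (hy : 0 < y) (a : ℂ) : pw (x / y) a = pw x a * pw y (-a) := by
  simp only [pw, Real.log_div hx.ne' hy.ne', ofReal_sub, ← Complex.exp_add]
  congr 1; ring

lemma pw_one {x : ℝ} (hx : 0 < x) : pw x 1 = x := by
  rw [← pw_eq hx, cpow_one]

lemma norm_pw (x : ℝ) (a : ℂ) : ((‖pw x a‖ : ℝ) : ℂ) = pw x (a.re : ℂ) := by
  simp only [pw, Complex.norm_exp]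
  simp

lemma norm_pw_le (x t : ℝ) : ‖pw x (-(t * I))‖ ≤ 1 := by
  simp [pw, Complex.norm_exp]

@[fun_prop]
lemma measurable_pw {α : Type*} [MeasurableSpace α] {f : α → ℝ} {g : α → ℂ}
    (hf : Measurable f) (hg : Measurable g) :
    Measurable (fun x => pw (f x) (g x)) := by
  unfold pw
  fun_prop

/-- The beta kernel on the half line. -/
noncomputable def kk (a b : ℂ) (x : ℝ) : ℂ := pw x (a - 1) * pw (1 + x) (-(a + b))

lemma beta_aux {a b : ℂ} (ha : 0 < a.re) (hb : 0 < b.re) :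
    IntegrableOn (kk a b) (Ioi 0) ∧ ∫ x in Ioi (0:ℝ), kk a b x = betaC a b := by
  set g : ℝ → ℂ := fun x => (x : ℂ) ^ (a - 1) * (1 - (x : ℂ)) ^ (b - 1) with hg
  have him : (fun x : ℝ => x / (1 + x)) '' Ioi 0 = Ioo 0 1 := by
    ext y
    simp only [mem_image, mem_Ioi, mem_Ioo]
    constructor
    · rintro ⟨x, hx, rfl⟩
      exact ⟨by positivity, by rw [div_lt_one (by positivity)]; linarith⟩
    · rintro ⟨h0, h1⟩
      refine ⟨y / (1 - y), div_pos h0 (by linarith), ?_⟩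
      have : (1 - y) ≠ 0 := by linarith
      field_simp
      ring
  have hd : ∀ x ∈ Ioi (0:ℝ), HasDerivWithinAt (fun x : ℝ => x / (1 + x)) (1 / (1 + x) ^ 2)
      (Ioi 0) x := by
    intro x hx
    have hx : 0 < x := hx
    have h1 : HasDerivAt (fun x : ℝ => 1 + x) 1 x := (hasDerivAt_id x).const_add 1
    have := (hasDerivAt_id x).div h1 (by positivity)
    convert! this.hasDerivWithinAt using 1
    simp
  have hinj : InjOn (fun x : ℝ => x / (1 + x)) (Ioi 0) := by
    intro x hx y hy h
    have hx : 0 < x := hx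
    have hy : 0 < y := hy
    simp only at h
    rw [div_eq_div_iff (by positivity) (by positivity)] at h
    linarith
  have hk : ∀ x ∈ Ioi (0:ℝ), |1 / (1 + x) ^ 2| • g (x / (1 + x)) = kk a b x := by
    intro x hx
    have hx : 0 < x := hx
    have h1 : 0 < 1 + x := by positivity
    have h2 : (1 : ℂ) - ((x / (1 + x) : ℝ) : ℂ) = ((1 / (1 + x) : ℝ) : ℂ) := by
      have h3 : (1 : ℝ) - x / (1 + x) = 1 / (1 + x) := by field_simp; ring
      rw [← h3]; push_cast; ring
    have h4 : (((1 / (1 + x) ^ 2 : ℝ)) : ℂ) = pw (1 + x) (-2) := by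
      rw [← pw_eq h1]
      rw [cpow_neg]
      push_cast
      norm_num
    simp only [hg]
    rw [h2, pw_eq (by positivity), pw_eq (by positivity), abs_of_pos (by positivity), real_smul, h4,
      pw_div hx h1, pw_div one_pos h1, kk]
    simp only [pw, ← Complex.exp_add]
    congr 1
    simp
    ring
  have hbi := Complex.betaIntegral_eq_Gamma_mul_div a b ha hb
  have hc := Complex.betaIntegral_convergent ha hb
  rw [intervalIntegrable_iff_integrableOn_Ioo_of_le zero_le_one] at hc
  rw [betaIntegral, intervalIntegral.integral_of_le zero_le_one, integral_Ioc_eq_integral_Ioo] at hbi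
  constructor
  · rw [← him, integrableOn_image_iff_integrableOn_abs_deriv_smul measurableSet_Ioi hd hinj] at hc
    exact hc.congr_fun hk measurableSet_Ioi
  · rw [← him, integral_image_eq_integral_abs_deriv_smul measurableSet_Ioi hd hinj] at hbi
    rw [betaC, ← hbi]
    exact (setIntegral_congr_fun measurableSet_Ioi hk).symm

lemma norm_Gamma_le {s : ℂ} (hs : 0 < s.re) : ‖Complex.Gamma s‖ ≤ Real.Gamma s.re := by
  rw [Complex.Gamma_eq_integral hs, Real.Gamma_eq_integral hs, Complex.GammaIntegral]
  refine (norm_integral_le_integral_norm _).trans (le_of_eq ?_)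
  refine setIntegral_congr_fun measurableSet_Ioi fun x hx => ?_
  have hx : 0 < x := hx
  simp [norm_cpow_eq_rpow_re_of_pos hx, Complex.norm_exp]

lemma cont_gamma {f : ℝ → ℂ} (hf : Continuous f) (h : ∀ t, 0 < (f t).re) :
    Continuous fun t => Complex.Gamma (f t) := by
  rw [continuous_iff_continuousAt]
  intro t
  have : DifferentiableAt ℂ Complex.Gamma (f t) := by
    apply Complex.differentiableAt_Gamma
    intro m hm
    have := h t
    rw [hm] at this
    simp at this
    have : (0:ℝ) ≤ m := by positivity
    linarith
  exact ContinuousAt.comp (f := f) this.continuousAt hf.continuousAt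

lemma integrable_beta {A B : ℂ} (hA : 0 < A.re) (hB : 0 < B.re) :
    Integrable (fun t : ℝ => betaC (A + (t : ℂ) * I) (B - (t : ℂ) * I)) := by
  have hcont : Continuous (fun t : ℝ => betaC (A + (t : ℂ) * I) (B - (t : ℂ) * I)) := by
    unfold betaC
    have hs : ∀ t : ℝ, (A + (t : ℂ) * I + (B - (t : ℂ) * I)) = A + B := fun t => by ring
    simp only [hs]
    refine Continuous.div_const (Continuous.mul ?_ ?_) _
    · exact cont_gamma (by fun_prop) (by intro t; simpa using hA)
    · exact cont_gamma (by fun_prop) (by intro t; simpa using hB)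
  have hi0 : Integrable (fun t : ℝ => (1 + t ^ 2)⁻¹) := integrable_inv_one_add_sq
  -- compare `‖A + it‖⁻¹ ‖B - it‖⁻¹` with two shifted Cauchy densities
  set K := Real.Gamma (A.re + 1) * Real.Gamma (B.re + 1) / ‖Complex.Gamma (A + B)‖ with hK
  have hi : ∀ c : ℝ, ∀ y : ℝ, 0 < c → Integrable (fun t : ℝ => (c ^ 2 + (t + y) ^ 2)⁻¹) := by
    intro c y hc
    have h1 := ((hi0.comp_div (R := c) hc.ne').comp_add_right y).const_mul (c ^ 2)⁻¹
    refine h1.congr (Eventually.of_forall fun t => ?_)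
    simp only
    rw [← mul_inv]
    congr 1
    field_simp
  have hdom := ((hi A.re A.im hA).add (hi B.re (-B.im) hB)).const_mul K
  refine hdom.mono' hcont.aestronglyMeasurable (Eventually.of_forall fun t => ?_)
  simp only [Pi.add_apply]
  have ha : (A + (t : ℂ) * I) ≠ 0 := fun h => by
    have := congrArg re h; simp at this; linarith
  have hb : (B - (t : ℂ) * I) ≠ 0 := fun h => by
    have := congrArg re h; simp at this; linarith
  have ea := Complex.Gamma_add_one _ ha
  have eb := Complex.Gamma_add_one _ hb
  have na := norm_Gamma_le (s := A + (t : ℂ) * I + 1) (by simp; linarith)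
  have nb := norm_Gamma_le (s := B - (t : ℂ) * I + 1) (by simp; linarith)
  rw [ea, norm_mul] at na
  rw [eb, norm_mul] at nb
  simp at na nb
  have hs : (A + (t : ℂ) * I + (B - (t : ℂ) * I)) = A + B := by ring
  have pa : 0 < ‖A + (t : ℂ) * I‖ := norm_pos_iff.2 ha
  have pb : 0 < ‖B - (t : ℂ) * I‖ := norm_pos_iff.2 hb
  have sa : ‖A + (t : ℂ) * I‖ ^ 2 = A.re ^ 2 + (t + A.im) ^ 2 := by
    rw [← normSq_eq_norm_sq, normSq_apply]; simp; ring
  have sb : ‖B - (t : ℂ) * I‖ ^ 2 = B.re ^ 2 + (t + -B.im) ^ 2 := by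
    rw [← normSq_eq_norm_sq, normSq_apply]; simp; ring
  rw [← sa, ← sb, betaC, hs, norm_div, norm_mul, hK]
  set x := ‖A + (t : ℂ) * I‖
  set y := ‖B - (t : ℂ) * I‖
  have hg1 : 0 < Real.Gamma (A.re + 1) := Real.Gamma_pos_of_pos (by linarith)
  have hg2 : 0 < Real.Gamma (B.re + 1) := Real.Gamma_pos_of_pos (by linarith)
  have e1 : ‖Complex.Gamma (A + (t : ℂ) * I)‖ ≤ Real.Gamma (A.re + 1) * x⁻¹ := by
    rw [← div_eq_mul_inv, le_div_iff₀ pa]; linarith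
  have e2 : ‖Complex.Gamma (B - (t : ℂ) * I)‖ ≤ Real.Gamma (B.re + 1) * y⁻¹ := by
    rw [← div_eq_mul_inv, le_div_iff₀ pb]; linarith
  have e3 : x⁻¹ * y⁻¹ ≤ (x ^ 2)⁻¹ + (y ^ 2)⁻¹ := by
    rw [← inv_pow, ← inv_pow]
    nlinarith [sq_nonneg (x⁻¹ - y⁻¹), sq_nonneg (x⁻¹ + y⁻¹)]
  calc _ ≤ (Real.Gamma (A.re + 1) * x⁻¹) * (Real.Gamma (B.re + 1) * y⁻¹) / ‖Complex.Gamma (A + B)‖ := by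
        gcongr
    _ = Real.Gamma (A.re + 1) * Real.Gamma (B.re + 1) / ‖Complex.Gamma (A + B)‖ * (x⁻¹ * y⁻¹) := by ring
    _ ≤ _ := by gcongr

lemma mellin_kk {A B : ℂ} (hA : 0 < A.re) (hB : 0 < B.re) {x : ℝ} (hx : 0 < x) :
    ∫ t : ℝ, betaC (A + (t : ℂ) * I) (B - (t : ℂ) * I) * pw x (-(t * I)) =
      2 * (Real.pi : ℂ) * (pw x A * pw (1 + x) (-(A + B))) := by
  set f : ℝ → ℂ := fun u => pw (1 + u) (-(A + B)) with hf
  have hcongr : ∀ s : ℂ, ∀ u ∈ Ioi (0:ℝ), (u : ℂ) ^ (s - 1) • f u = kk s (A + B - s) u := by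
    intro s u hu
    rw [pw_eq hu, smul_eq_mul, kk]
    simp [hf]
  have hre : ∀ y : ℝ, 0 < ((A.re : ℂ) + y * I).re := by intro y; simpa using hA
  have hre' : ∀ y : ℝ, 0 < (A + B - ((A.re : ℂ) + y * I)).re := by intro y; simpa using hB
  have hm : ∀ y : ℝ, mellin f ((A.re : ℂ) + y * I) =
      betaC (A + ((y - A.im : ℝ) : ℂ) * I) (B - ((y - A.im : ℝ) : ℂ) * I) := by
    intro y
    rw [mellin, setIntegral_congr_fun measurableSet_Ioi (hcongr _), (beta_aux (hre y) (hre' y)).2]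
    have h0 : (A.re : ℂ) + y * I = A + ((y - A.im : ℝ) : ℂ) * I := by
      apply Complex.ext <;> simp
    rw [h0]
    congr 1
    ring
  have hconv : MellinConvergent f (A.re : ℂ) := by
    have := (beta_aux (hre 0) (hre' 0)).1.congr_fun (fun u hu => (hcongr _ u hu).symm)
      measurableSet_Ioi
    simpa [MellinConvergent] using this
  have hv : VerticalIntegrable (mellin f) A.re := by
    unfold VerticalIntegrable
    simp only [hm]
    exact (integrable_beta hA hB).comp_sub_right A.im
  have hc : ContinuousAt f x := by
    have : ContinuousAt (fun u : ℝ => Real.log (1 + u)) x :=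
      ContinuousAt.log (by fun_prop) (by positivity)
    simp only [hf, pw]
    fun_prop
  have h := mellinInv_mellin_eq A.re f hx hconv hv hc
  rw [mellinInv] at h
  simp only [hm] at h
  have h2 := integral_add_right_eq_self (μ := volume) (fun y : ℝ => (x : ℂ) ^ (-((A.re : ℂ) + y * I)) •
    betaC (A + ((y - A.im : ℝ) : ℂ) * I) (B - ((y - A.im : ℝ) : ℂ) * I)) A.im
  rw [← h2] at h
  have h3 : ∀ t : ℝ, (x : ℂ) ^ (-((A.re : ℂ) + ((t + A.im : ℝ) : ℂ) * I)) •
      betaC (A + ((t + A.im - A.im : ℝ) : ℂ) * I) (B - ((t + A.im - A.im : ℝ) : ℂ) * I) =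
      pw x (-A) * (betaC (A + (t : ℂ) * I) (B - (t : ℂ) * I) * pw x (-(t * I))) := by
    intro t
    have h0 : -((A.re : ℂ) + ((t + A.im : ℝ) : ℂ) * I) = -A + -(t * I) := by
      apply Complex.ext <;> simp
    rw [h0, pw_eq hx, pw_add, add_sub_cancel_right, smul_eq_mul]
    ring
  simp only [h3] at h
  rw [integral_const_mul] at h
  set J := ∫ t : ℝ, betaC (A + (t : ℂ) * I) (B - (t : ℂ) * I) * pw x (-(t * I))
  have hp : pw x A * pw x (-A) = 1 := by rw [← pw_add]; simp [pw]
  have hpi : (Real.pi : ℂ) ≠ 0 := by exact_mod_cast Real.pi_ne_zero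
  change _ = 2 * (Real.pi : ℂ) * (pw x A * f x)
  rw [← h, real_smul]
  push_cast
  calc J = (pw x A * pw x (-A)) * J := by rw [hp, one_mul]
    _ = _ := by field_simp

/-- The two-variable kernel after the first substitution. -/
noncomputable def mm (a b c d : ℂ) (v q : ℝ) : ℂ :=
  pw v (a - 1) * pw q (a + c - 1) * pw (1 + q) (-(c + d - b)) * pw (1 + q + q * v) (-(a + b))

lemma mm_subst (a b c d : ℂ) {p q : ℝ} (hp : 0 < p) (hq : 0 < q) :
    (((1 + q) / q : ℝ) : ℂ) * mm a b c d ((1 + q) / q * p) q = kk a b p * kk c d q := by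
  have h1 : 0 < 1 + q := by positivity
  have h2 : 0 < 1 + p := by positivity
  have h3 : 1 + q + q * ((1 + q) / q * p) = (1 + q) * (1 + p) := by field_simp
  rw [← pw_one (x := (1 + q) / q) (by positivity), mm, h3, pw_mul (by positivity) hp, pw_div h1 hq,
    pw_div h1 hq, pw_mul h1 h2, kk, kk]
  simp only [pw, ← Complex.exp_add]
  congr 1
  ring

lemma mm_section {a b : ℂ} (ha : 0 < a.re) (hb : 0 < b.re) (c d : ℂ) {q : ℝ} (hq : 0 < q) :
    IntegrableOn (fun v => mm a b c d v q) (Ioi 0) ∧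
      ∫ v in Ioi (0:ℝ), mm a b c d v q = betaC a b * kk c d q := by
  have hm : 0 < (1 + q) / q := by positivity
  have hmc : (((1 + q) / q : ℝ) : ℂ) ≠ 0 := by exact_mod_cast hm.ne'
  obtain ⟨h1, h2⟩ := beta_aux ha hb
  have key : ∀ p ∈ Ioi (0:ℝ), mm a b c d ((1 + q) / q * p) q =
      (((1 + q) / q : ℝ) : ℂ)⁻¹ * kk c d q * kk a b p := by
    intro p hp
    have := mm_subst a b c d hp hq
    rw [mul_assoc, mul_comm (kk c d q), ← this, inv_mul_cancel_left₀ hmc]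
  constructor
  · have := integrableOn_Ioi_comp_mul_left_iff (fun v => mm a b c d v q) 0 hm
    rw [mul_zero] at this
    rw [← this]
    exact IntegrableOn.congr_fun (h1.const_mul _) (fun p hp => (key p hp).symm) measurableSet_Ioi
  · have := integral_comp_mul_left_Ioi' (fun v => mm a b c d v q) 0 hm
    rw [mul_zero] at this
    rw [← this, setIntegral_congr_fun measurableSet_Ioi key, integral_const_mul, h2, real_smul]
    field_simp

lemma mm_integrable {a b c d : ℂ} (ha : 0 < a.re) (hb : 0 < b.re) (hc : 0 < c.re) (hd : 0 < d.re) :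
    Integrable (Function.uncurry (mm a b c d))
      ((volume.restrict (Ioi 0)).prod (volume.restrict (Ioi 0))) := by
  have hmeas : Measurable (Function.uncurry (mm a b c d)) := by
    unfold mm Function.uncurry
    fun_prop
  rw [integrable_prod_iff' hmeas.aestronglyMeasurable]
  constructor
  · filter_upwards [self_mem_ae_restrict measurableSet_Ioi] with q hq
    exact (mm_section ha hb c d hq).1
  · have hn : ∀ v q, ((‖mm a b c d v q‖ : ℝ) : ℂ) = mm a.re b.re c.re d.re v q := by
      intro v q
      simp only [mm, norm_mul, ofReal_mul, norm_pw]
      simp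
    have h := (beta_aux (a := (c.re : ℂ)) (b := (d.re : ℂ)) (by simpa) (by simpa)).1
    have h' := (h.const_mul (betaC a.re b.re)).norm
    refine Integrable.congr h' ?_
    filter_upwards [self_mem_ae_restrict measurableSet_Ioi] with q hq
    have := (mm_section (a := (a.re : ℂ)) (b := (b.re : ℂ)) (by simpa) (by simpa) c.re d.re hq).2
    simp only [← hn] at this
    rw [integral_complex_ofReal] at this
    rw [← this, norm_real, Real.norm_of_nonneg]
    · rfl
    · exact integral_nonneg fun _ => norm_nonneg _

lemma double_int {A₁ A₂ A₃ B₁ B₂ : ℂ}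
    (hA₁ : 0 < A₁.re) (hA₂ : 0 < A₂.re) (hA₃ : 0 < A₃.re)
    (hB₁ : 0 < B₁.re) (hB₂ : 0 < B₂.re) :
    ∫ v in Ioi (0:ℝ), ∫ r in Ioi (0:ℝ),
      pw v (A₂ + B₁ - 1) * pw (1 + v) (-(A₂ + B₂)) * pw r (A₁ + A₂ + B₁ + B₂ - 1) *
        pw (1 + r) (-(A₂ + A₃ + B₁ + B₂)) * pw (1 + r + v) (-(A₁ + B₁)) =
    betaC (A₂ + B₁) (A₃ + B₂) * betaC (A₁ + B₂) (A₃ + B₁) := by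
  have ha : 0 < (A₂ + B₁).re := by simp; linarith
  have hb : 0 < (A₃ + B₂).re := by simp; linarith
  have hc : 0 < (A₁ + B₂).re := by simp; linarith
  have hd : 0 < (A₃ + B₁).re := by simp; linarith
  have step : ∀ v ∈ Ioi (0:ℝ), ∫ r in Ioi (0:ℝ),
      pw v (A₂ + B₁ - 1) * pw (1 + v) (-(A₂ + B₂)) * pw r (A₁ + A₂ + B₁ + B₂ - 1) *
        pw (1 + r) (-(A₂ + A₃ + B₁ + B₂)) * pw (1 + r + v) (-(A₁ + B₁)) =
      ∫ q in Ioi (0:ℝ), mm (A₂ + B₁) (A₃ + B₂) (A₁ + B₂) (A₃ + B₁) v q := by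
    intro v hv
    have hv : 0 < v := hv
    have hv1 : 0 < 1 + v := by positivity
    have := integral_comp_mul_left_Ioi' (fun r => pw v (A₂ + B₁ - 1) * pw (1 + v) (-(A₂ + B₂)) *
      pw r (A₁ + A₂ + B₁ + B₂ - 1) *
        pw (1 + r) (-(A₂ + A₃ + B₁ + B₂)) * pw (1 + r + v) (-(A₁ + B₁))) 0 hv1
    rw [mul_zero] at this
    rw [← this, ← integral_smul]
    refine setIntegral_congr_fun measurableSet_Ioi fun q hq => ?_
    have hq : 0 < q := hq
    have hq1 : 0 < 1 + q := by positivity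
    have e1 : 1 + (1 + v) * q + v = (1 + v) * (1 + q) := by ring
    have e2 : 1 + (1 + v) * q = 1 + q + q * v := by ring
    rw [e1, e2, real_smul, ← pw_one hv1, pw_mul hv1 hq, pw_mul hv1 hq1, mm]
    simp only [pw, ← Complex.exp_add]
    congr 1
    ring
  rw [setIntegral_congr_fun measurableSet_Ioi step,
    integral_integral_swap (mm_integrable ha hb hc hd),
    setIntegral_congr_fun measurableSet_Ioi fun q hq => (mm_section ha hb _ _ hq).2,
    integral_const_mul, (beta_aux hc hd).2]

/-- Barnes' second lemma in beta-function form: for parameters with positive real parts,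
the principal-value contour integral along the imaginary axis (`s = it`, `ds = i dt`)
`(1/(2πi)) ∫_{−i∞}^{i∞} B(A₁+s, B₁−s)·B(A₂+s, B₂−s)·B(A₃+s, A₁+A₂+B₁+B₂) ds`
equals `B(A₂+B₁, A₃+B₂)·B(A₁+B₂, A₃+B₁)`. -/
theorem stmt18 (A₁ A₂ A₃ B₁ B₂ : ℂ)
    (hA₁ : 0 < A₁.re) (hA₂ : 0 < A₂.re) (hA₃ : 0 < A₃.re)
    (hB₁ : 0 < B₁.re) (hB₂ : 0 < B₂.re) :
    Tendsto (fun R : ℝ =>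
        (1 / (2 * (Real.pi : ℂ) * Complex.I)) *
          ∫ t in (-R)..R,
            betaC (A₁ + (t : ℂ) * Complex.I) (B₁ - (t : ℂ) * Complex.I) *
              betaC (A₂ + (t : ℂ) * Complex.I) (B₂ - (t : ℂ) * Complex.I) *
              betaC (A₃ + (t : ℂ) * Complex.I) (A₁ + A₂ + B₁ + B₂) * Complex.I)
      atTop (nhds (betaC (A₂ + B₁) (A₃ + B₂) * betaC (A₁ + B₂) (A₃ + B₁))) := by
  set C := A₁ + A₂ + B₁ + B₂ with hC
  have hCre : 0 < C.re := by simp [hC]; linarith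
  set μ : Measure ℝ := volume.restrict (Ioi 0) with hμ
  set F : ℝ → ℝ × ℝ → ℂ := fun t z =>
    pw ((1 + z.2) / z.1) (-(t * I)) *
      (betaC (A₁ + (t : ℂ) * I) (B₁ - (t : ℂ) * I) * (kk A₂ B₂ z.1 * kk C A₃ z.2)) with hF
  have hprod : Integrable (fun z : ℝ × ℝ => kk A₂ B₂ z.1 * kk C A₃ z.2) (μ.prod μ) :=
    (beta_aux hA₂ hB₂).1.mul_prod (beta_aux hCre hA₃).1
  have hFint : Integrable (Function.uncurry F) (volume.prod (μ.prod μ)) := by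
    have h1 := (integrable_beta hA₁ hB₁).mul_prod hprod
    refine h1.bdd_mul (c := 1) (f := fun w : ℝ × ℝ × ℝ => pw ((1 + w.2.2) / w.2.1) (-(w.1 * I))) ?_ ?_
    · apply Measurable.aestronglyMeasurable
      fun_prop
    · exact Eventually.of_forall fun w => norm_pw_le _ _
  have hpos : ∀ᵐ z ∂(μ.prod μ), 0 < z.1 ∧ 0 < z.2 := by
    rw [hμ, Measure.prod_restrict]
    filter_upwards [self_mem_ae_restrict (measurableSet_Ioi.prod measurableSet_Ioi)] with z hz
    exact hz
  have hinner : ∀ t : ℝ, ∫ z, F t z ∂(μ.prod μ) =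
      betaC (A₁ + (t : ℂ) * I) (B₁ - (t : ℂ) * I) *
        betaC (A₂ + (t : ℂ) * I) (B₂ - (t : ℂ) * I) * betaC (A₃ + (t : ℂ) * I) C := by
    intro t
    have e : ∀ᵐ z ∂(μ.prod μ), F t z = betaC (A₁ + (t : ℂ) * I) (B₁ - (t : ℂ) * I) *
        (kk (A₂ + (t : ℂ) * I) (B₂ - (t : ℂ) * I) z.1 * kk C (A₃ + (t : ℂ) * I) z.2) := by
      filter_upwards [hpos] with z hz
      obtain ⟨h1, h2⟩ := hz
      simp only [hF]
      rw [mul_left_comm, pw_div (by positivity) h1]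
      congr 1
      simp only [kk, pw, ← Complex.exp_add]
      congr 1
      ring
    rw [integral_congr_ae e, integral_const_mul, integral_prod_mul,
      (beta_aux (by simpa using hA₂) (by simpa using hB₂)).2,
      (beta_aux hCre (by simpa using hA₃)).2, mul_assoc]
    congr 2
    simp only [betaC]
    rw [mul_comm (Complex.Gamma C), add_comm C]
  have hswap : ∫ t : ℝ, ∫ z, F t z ∂(μ.prod μ) =
      2 * (Real.pi : ℂ) * (betaC (A₂ + B₁) (A₃ + B₂) * betaC (A₁ + B₂) (A₃ + B₁)) := by
    rw [integral_integral_swap hFint]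
    have hint : Integrable (fun z => ∫ t, F t z) (μ.prod μ) := hFint.integral_prod_right
    have e : ∀ᵐ z ∂(μ.prod μ), ∫ t, F t z = 2 * (Real.pi : ℂ) *
      (pw z.1 (A₂ + B₁ - 1) * pw (1 + z.1) (-(A₂ + B₂)) * pw z.2 (A₁ + A₂ + B₁ + B₂ - 1) *
        pw (1 + z.2) (-(A₂ + A₃ + B₁ + B₂)) * pw (1 + z.2 + z.1) (-(A₁ + B₁))) := by
      filter_upwards [hpos] with z hz
      obtain ⟨h1, h2⟩ := hz
      have h3 : 0 < 1 + z.2 := by positivity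
      have h4 : 1 + (1 + z.2) / z.1 = (1 + z.2 + z.1) / z.1 := by field_simp; ring
      have e1 : ∀ t : ℝ, F t z = (kk A₂ B₂ z.1 * kk C A₃ z.2) *
          (betaC (A₁ + (t : ℂ) * I) (B₁ - (t : ℂ) * I) * pw ((1 + z.2) / z.1) (-(t * I))) := by
        intro t
        simp only [hF]; ring
      simp only [e1]
      rw [integral_const_mul, mellin_kk hA₁ hB₁ (by positivity), mul_left_comm, h4,
        pw_div h3 h1, pw_div (by positivity) h1]
      congr 1
      simp only [kk, pw, ← Complex.exp_add, hC]
      congr 1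
      ring
    have hint2 := hint.congr e
    rw [integral_congr_ae e, integral_prod _ hint2]
    simp only [integral_const_mul]
    rw [double_int hA₁ hA₂ hA₃ hB₁ hB₂]
  have hit : Integrable (fun t => ∫ z, F t z ∂(μ.prod μ)) := hFint.integral_prod_left
  simp only [hinner] at hswap hit
  have hlim := (intervalIntegral_tendsto_integral (hit.mul_const I) tendsto_neg_atTop_atBot
    tendsto_id).const_mul (1 / (2 * (Real.pi : ℂ) * I))
  rw [integral_mul_const, hswap] at hlim
  have hpi : (Real.pi : ℂ) ≠ 0 := by exact_mod_cast Real.pi_ne_zero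
  have hval : ∀ X : ℂ, 1 / (2 * (Real.pi : ℂ) * I) * (2 * (Real.pi : ℂ) * X * I) = X := by
    intro X
    have hI := I_ne_zero
    field_simp
  rw [hval] at hlim
  exact hlim
end
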